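/- arXiv:2307.05226 — 3 statements merged into one kernel-verified Lean document; each statement's English description precedes it below -/
import Mathlib

section
/- With the notation of Saito's theorem (R Noetherian, Ω free of rank n with basis e₁,…,eₙ, ω₁,…,ω_k ∈ Ω, 𝔞 the ideal of coefficients of ω₁ ∧ ⋯ ∧ ω_k, Z^p = {ω ∈ Λ^p Ω : ω ∧ ω₁ ∧ ⋯ ∧ ω_k = 0}, H^p = Z^p / Σᵢ ωᵢ ∧ Λ^{p−1}Ω): for every p with p < depth_𝔞(R), one has H^p = 0. -/
open ExteriorAlgebra


/-- The `p`-th exterior power `Λ^p Ω` of `Ω = Rⁿ`, as a submodule of the exterior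
algebra: the span of all products of `p` elements of `Ω`. -/
def extPow (R : Type*) [CommRing R] (n p : ℕ) :
    Submodule R (ExteriorAlgebra R (Fin n → R)) :=
  Submodule.span R
    {x | ∃ v : Fin p → (Fin n → R), x = (List.ofFn fun i => ι R (v i)).prod}

/-- The wedge product `ω₁ ∧ ⋯ ∧ ω_k` in the exterior algebra of `Rⁿ`. -/
def wedgeProd {R : Type*} [CommRing R] {n k : ℕ} (ω : Fin k → (Fin n → R)) :
    ExteriorAlgebra R (Fin n → R) :=
  (List.ofFn fun i => ι R (ω i)).prod

/-- The ideal `𝔞` generated by the coefficients `a_{i₁,…,i_k}` of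
`ω₁ ∧ ⋯ ∧ ω_k = Σ a_{i₁,…,i_k} e_{i₁} ∧ ⋯ ∧ e_{i_k}`; these coefficients are the
maximal minors of the `k × n` matrix of the `ωᵢ`. -/
def coeffIdeal {R : Type*} [CommRing R] {n k : ℕ} (ω : Fin k → (Fin n → R)) : Ideal R :=
  Ideal.span (Set.range fun s : Fin k ↪o Fin n =>
    Matrix.det (Matrix.of fun r c : Fin k => ω r (s c)))


namespace SaitoAux

section general
variable {R : Type*} [CommRing R] {M : Type*} [AddCommGroup M] [Module R M]

/-- contraction on the left by a linear form -/
noncomputable def ctr (d : Module.Dual R M) : ExteriorAlgebra R M →ₗ[R] ExteriorAlgebra R M :=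
  CliffordAlgebra.contractLeft (Q := (0 : QuadraticForm R M)) d

lemma ctr_ι_mul (d : Module.Dual R M) (a : M) (b : ExteriorAlgebra R M) :
    ctr d (ι R a * b) = d a • b - ι R a * ctr d b :=
  CliffordAlgebra.contractLeft_ι_mul (Q := (0 : QuadraticForm R M)) d a b

lemma ctr_one (d : Module.Dual R M) : ctr d (1 : ExteriorAlgebra R M) = 0 :=
  CliffordAlgebra.contractLeft_one (Q := (0 : QuadraticForm R M)) d

lemma ctr_ιMulti (d : Module.Dual R M) : ∀ (k : ℕ) (w : Fin (k + 1) → M),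
    ctr d (ιMulti R (k + 1) w) =
      ∑ i : Fin (k + 1), ((-1) ^ (i : ℕ) * d (w i)) • ιMulti R k (fun j => w (i.succAbove j)) := by
  intro k
  induction k with
  | zero =>
    intro w
    rw [ιMulti_succ_apply, ctr_ι_mul]
    simp [ιMulti_zero_apply, ctr_one]
  | succ k ih =>
    intro w
    rw [ιMulti_succ_apply, ctr_ι_mul, ih, Finset.mul_sum, sub_eq_add_neg,
      ← Finset.sum_neg_distrib, Fin.sum_univ_succ (n := k + 1)]
    congr 1
    · simp [Matrix.vecTail, Function.comp_def]
    · refine Finset.sum_congr rfl fun i _ => ?_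
      rw [ιMulti_succ_apply (v := fun j => w (i.succ.succAbove j))]
      simp [Matrix.vecTail, Function.comp_def, pow_succ]

/-- iterated contraction -/
noncomputable def ictr : (k : ℕ) → (Fin k → Module.Dual R M) →
    (ExteriorAlgebra R M →ₗ[R] ExteriorAlgebra R M)
  | 0, _ => LinearMap.id
  | k + 1, d => (ictr k (fun i => d i.succ)).comp (ctr (d 0))

lemma ictr_ιMulti : ∀ (k : ℕ) (d : Fin k → Module.Dual R M) (w : Fin k → M),
    ictr k d (ιMulti R k w) =
      algebraMap R _ (Matrix.det (Matrix.of fun i j => d i (w j))) := by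
  intro k
  induction k with
  | zero => intro d w; simp [ictr, ιMulti_zero_apply]
  | succ k ih =>
    intro d w
    rw [ictr, LinearMap.comp_apply, ctr_ιMulti, map_sum, Matrix.det_succ_row_zero, map_sum]
    refine Finset.sum_congr rfl fun i _ => ?_
    rw [map_smul, ih, Algebra.smul_def, ← map_mul]
    rfl

/-- the ideal power `W^r Λ` -/
def J (W : Submodule R (ExteriorAlgebra R M)) (r : ℕ) : Submodule R (ExteriorAlgebra R M) :=
  W ^ r * ⊤

variable {W : Submodule R (ExteriorAlgebra R M)}

lemma J_zero : J W 0 = ⊤ := by simp [J]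

lemma J_succ (r : ℕ) : J W (r + 1) = W * J W r := by
  simp [J, pow_succ', mul_assoc]

lemma J_succ_le (r : ℕ) : J W (r + 1) ≤ J W r := by
  induction r with
  | zero => simp [J_zero]
  | succ r ih => 
    calc J W (r + 1 + 1) = W * J W (r + 1) := J_succ _
      _ ≤ W * J W r := mul_le_mul' le_rfl ih
      _ = J W (r + 1) := (J_succ r).symm

lemma J_mul (r : ℕ) {x : ExteriorAlgebra R M} (hx : x ∈ J W r) (y : ExteriorAlgebra R M) :
    x * y ∈ J W r := by
  have : x * y ∈ J W r * ⊤ := Submodule.mul_mem_mul hx trivial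
  rw [J, mul_assoc] at this
  exact (mul_le_mul' le_rfl le_top : W ^ r * (⊤ * ⊤) ≤ W ^ r * ⊤) this

lemma ctr_J (hW : W ≤ LinearMap.range (ι R)) (d : Module.Dual R M) (r : ℕ) :
    ∀ x ∈ J W (r + 1), ctr d x ∈ J W r := by
  induction r with
  | zero => intro x _; simp [J_zero]
  | succ r ih =>
    intro x hx
    rw [J_succ] at hx
    induction hx using Submodule.mul_induction_on' with
    | mem_mul_mem m hm y hy =>
      obtain ⟨a, rfl⟩ := hW hm
      rw [ctr_ι_mul]
      refine sub_mem (Submodule.smul_mem _ _ hy) ?_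
      rw [J_succ]
      exact Submodule.mul_mem_mul hm (ih y hy)
    | add x _ y _ hx hy => rw [map_add]; exact add_mem hx hy

lemma ctr_pow (hW : W ≤ LinearMap.range (ι R)) (d : Module.Dual R M) (r : ℕ) :
    ∀ x ∈ W ^ (r + 1), ctr d x ∈ W ^ r := by
  induction r with
  | zero =>
    intro x hx
    rw [zero_add, pow_one] at hx
    obtain ⟨a, rfl⟩ := hW hx
    rw [← mul_one (ι R a), ctr_ι_mul, ctr_one, mul_zero, sub_zero, pow_zero]
    exact Submodule.smul_mem _ _ (Submodule.one_le.mp le_rfl)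
  | succ r ih =>
    intro x hx
    rw [pow_succ'] at hx
    induction hx using Submodule.mul_induction_on' with
    | mem_mul_mem m hm y hy =>
      obtain ⟨a, rfl⟩ := hW hm
      rw [ctr_ι_mul]
      refine sub_mem (Submodule.smul_mem _ _ hy) ?_
      rw [pow_succ']
      exact Submodule.mul_mem_mul hm (ih y hy)
    | add x _ y _ hx hy => rw [map_add]; exact add_mem hx hy

lemma ctr_mul (hW : W ≤ LinearMap.range (ι R)) (d : Module.Dual R M) (z : ExteriorAlgebra R M)
    (r : ℕ) : ∀ y ∈ W ^ r, ctr d (y * z) - ctr d y * z ∈ J W r := by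
  induction r with
  | zero => intro y _; simp [J_zero]
  | succ r ih =>
    intro y hy
    rw [pow_succ'] at hy
    induction hy using Submodule.mul_induction_on' with
    | mem_mul_mem m hm y hy =>
      obtain ⟨a, rfl⟩ := hW hm
      have : ctr d (ι R a * y * z) - ctr d (ι R a * y) * z
          = ι R a * (-(ctr d (y * z) - ctr d y * z)) := by
        rw [mul_assoc, ctr_ι_mul, ctr_ι_mul, sub_mul, smul_mul_assoc, neg_sub, mul_sub, mul_assoc]
        abel
      rw [this, J_succ]
      exact Submodule.mul_mem_mul hm (neg_mem (ih y hy))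
    | add x _ y _ hx hy =>
      rw [add_mul, map_add, map_add, add_mul, add_sub_add_comm]; exact add_mem hx hy

lemma ictr_J (hW : W ≤ LinearMap.range (ι R)) (r : ℕ) : ∀ (k : ℕ) (d : Fin k → Module.Dual R M),
    ∀ x ∈ J W (r + k), ictr k d x ∈ J W r := by
  intro k
  induction k with
  | zero => intro d x hx; exact hx
  | succ k ih => intro d x hx; exact ih _ _ (ctr_J hW _ _ _ hx)

lemma ictr_mul (hW : W ≤ LinearMap.range (ι R)) (z : ExteriorAlgebra R M) :
    ∀ (k : ℕ) (d : Fin k → Module.Dual R M),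
    ∀ y ∈ W ^ k, ictr k d (y * z) - ictr k d y * z ∈ J W 1 := by
  intro k
  induction k with
  | zero => intro d y _; simp [ictr]
  | succ k ih =>
    intro d y hy
    have h1 := ctr_mul hW (d 0) z (k + 1) y hy
    have h2 := ih (fun i => d i.succ) _ (ctr_pow hW (d 0) k y hy)
    replace h1 : ctr (d 0) (y * z) - ctr (d 0) y * z ∈ J W (1 + k) := add_comm k 1 ▸ h1
    have h3 := ictr_J hW 1 k (fun i => d i.succ) _ h1
    rw [map_sub] at h3
    have := add_mem h3 h2
    simpa [ictr] using this

lemma linmap_smul_top (f : ExteriorAlgebra R M →ₗ[R] ExteriorAlgebra R M) (I : Ideal R)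
    {x : ExteriorAlgebra R M} (hx : x ∈ I • (⊤ : Submodule R (ExteriorAlgebra R M))) :
    f x ∈ I • (⊤ : Submodule R (ExteriorAlgebra R M)) := by
  have : f x ∈ Submodule.map f (I • ⊤) := ⟨x, hx, rfl⟩
  rw [Submodule.map_smul''] at this
  exact Submodule.smul_mono le_rfl le_top this

lemma mul_smul_top (I : Ideal R) (y : ExteriorAlgebra R M)
    {x : ExteriorAlgebra R M} (hx : x ∈ I • (⊤ : Submodule R (ExteriorAlgebra R M))) :
    y * x ∈ I • (⊤ : Submodule R (ExteriorAlgebra R M)) :=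
  linmap_smul_top (LinearMap.mulLeft R y) I hx

/-- sign equivalence -/
lemma perm_prod {k : ℕ} (ω : Fin k → M) {l l' : List (Fin k)} (h : l.Perm l') :
    (l.map fun i => ι R (ω i)).prod = (l'.map fun i => ι R (ω i)).prod ∨
    (l.map fun i => ι R (ω i)).prod = -(l'.map fun i => ι R (ω i)).prod := by
  induction h with
  | nil => simp
  | cons x _ ih =>
    simp only [List.map_cons, List.prod_cons]
    rcases ih with h | h <;> rw [h] <;> simp
  | swap x y l =>
    right
    simp only [List.map_cons, List.prod_cons, ← mul_assoc]
    rw [← neg_mul, eq_neg_of_add_eq_zero_left (ι_add_mul_swap (R := R) (ω y) (ω x))]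
  | trans _ _ h1 h2 =>
    rcases h1 with h1 | h1 <;> rcases h2 with h2 | h2 <;> rw [h1, h2] <;> simp

lemma dup_prod {k : ℕ} (ω : Fin k → M) {l : List (Fin k)} (h : ¬ l.Nodup) :
    (l.map fun i => ι R (ω i)).prod = 0 := by
  induction l with
  | nil => simp at h
  | cons a l ih =>
    by_cases hl : l.Nodup
    · have ha : a ∈ l := by
        by_contra hc
        exact h (List.nodup_cons.mpr ⟨hc, hl⟩)
      have hp := (List.perm_cons_erase ha).cons a
      have h0 : ((a :: a :: l.erase a).map fun i => ι R (ω i)).prod = 0 := by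
        simp only [List.map_cons, List.prod_cons, ← mul_assoc, ι_sq_zero, zero_mul]
      rcases perm_prod (R := R) ω hp with h1 | h1 <;> rw [h1, h0]
      exact neg_zero
    · rw [List.map_cons, List.prod_cons, ih hl, mul_zero]

/-- the product of the `ω i`, `i ∈ S` -/
noncomputable def wS (R : Type*) [CommRing R] {M : Type*} [AddCommGroup M] [Module R M]
    {k : ℕ} (ω : Fin k → M) (S : Finset (Fin k)) : ExteriorAlgebra R M :=
  (S.toList.map fun i => ι R (ω i)).prod

/-- span of the `ω i` -/
def Wsp (R : Type*) [CommRing R] {M : Type*} [AddCommGroup M] [Module R M]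
    {k : ℕ} (ω : Fin k → M) : Submodule R (ExteriorAlgebra R M) :=
  Submodule.span R (Set.range fun i => ι R (ω i))

lemma Wsp_le {k : ℕ} (ω : Fin k → M) : Wsp R ω ≤ LinearMap.range (ι R) := by
  rw [Wsp, Submodule.span_le]
  rintro _ ⟨i, rfl⟩
  exact ⟨_, rfl⟩

lemma list_mem {k : ℕ} (ω : Fin k → M) (l : List (Fin k)) :
    (l.map fun i => ι R (ω i)).prod ∈ Wsp R ω ^ l.length := by
  induction l with
  | nil => simpa using Submodule.one_le.mp le_rfl
  | cons a l ih =>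
    rw [List.map_cons, List.prod_cons, List.length_cons, pow_succ']
    exact Submodule.mul_mem_mul (Submodule.subset_span ⟨a, rfl⟩) ih

lemma wS_mem {k : ℕ} (ω : Fin k → M) (S : Finset (Fin k)) : wS R ω S ∈ Wsp R ω ^ S.card := by
  simpa [wS] using list_mem (R := R) ω S.toList

/-- wedge of all -/
noncomputable def wAll (R : Type*) [CommRing R] {M : Type*} [AddCommGroup M] [Module R M]
    {k : ℕ} (ω : Fin k → M) : ExteriorAlgebra R M := ιMulti R k ω

lemma wAll_eq {k : ℕ} (ω : Fin k → M) :
    wAll R ω = ((List.finRange k).map fun i => ι R (ω i)).prod := by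
  rw [wAll, ιMulti_apply, List.ofFn_eq_map]

lemma wS_mul_disj {k : ℕ} (ω : Fin k → M) (S T : Finset (Fin k)) (h : ¬ Disjoint S T) :
    wS R ω S * wS R ω T = 0 := by
  rw [wS, wS, ← List.prod_append, ← List.map_append]
  apply dup_prod
  intro hn
  apply h
  rw [List.nodup_append'] at hn
  rw [Finset.disjoint_left]
  intro a ha hb
  exact hn.2.2 (Finset.mem_toList.mpr ha) (Finset.mem_toList.mpr hb)

lemma wS_mul_compl {k : ℕ} (ω : Fin k → M) (S : Finset (Fin k)) :
    wS R ω Sᶜ * wS R ω S = wAll R ω ∨ wS R ω Sᶜ * wS R ω S = - wAll R ω := by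
  rw [wS, wS, ← List.prod_append, ← List.map_append, wAll_eq]
  apply perm_prod
  rw [List.perm_ext_iff_of_nodup _ (List.nodup_finRange k)]
  · intro a
    simp only [List.mem_append, Finset.mem_toList, Finset.mem_compl, List.mem_finRange, iff_true]
    tauto
  · rw [List.nodup_append']
    refine ⟨Finset.nodup_toList _, Finset.nodup_toList _, ?_⟩
    intro a ha hb
    rw [Finset.mem_toList] at ha hb
    exact Finset.mem_compl.mp ha hb

lemma ι_mul_wS {k : ℕ} (ω : Fin k → M) (S : Finset (Fin k)) (i : Fin k) (hi : i ∉ S) :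
    ι R (ω i) * wS R ω S = wS R ω (insert i S) ∨
    ι R (ω i) * wS R ω S = - wS R ω (insert i S) := by
  have := perm_prod (R := R) ω (Finset.toList_insert hi).symm
  simpa [wS] using this

lemma ι_mul_wS' {k : ℕ} (ω : Fin k → M) (S : Finset (Fin k)) (i : Fin k) (hi : i ∈ S) :
    ι R (ω i) * wS R ω S = 0 := by
  have : ((i :: S.toList).map fun i => ι R (ω i)).prod = 0 := by
    apply dup_prod
    intro h
    exact (List.nodup_cons.mp h).1 (Finset.mem_toList.mpr hi)
  simpa [wS] using this

/-- sum map -/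
noncomputable def Lm {k : ℕ} (ω : Fin k → M) (r : ℕ) :
    (Finset (Fin k) → ExteriorAlgebra R M) →ₗ[R] ExteriorAlgebra R M :=
  ∑ S ∈ Finset.powersetCard r Finset.univ,
    (LinearMap.mulLeft R (wS R ω S)).comp (LinearMap.proj S)

lemma Lm_apply {k : ℕ} (ω : Fin k → M) (r : ℕ) (η : Finset (Fin k) → ExteriorAlgebra R M) :
    Lm ω r η = ∑ S ∈ Finset.powersetCard r Finset.univ, wS R ω S * η S := by
  simp [Lm]

lemma mem_range_Lm {k : ℕ} (ω : Fin k → M) (S : Finset (Fin k)) (η : ExteriorAlgebra R M) :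
    wS R ω S * η ∈ LinearMap.range (Lm (R := R) ω S.card) := by
  refine ⟨Pi.single S η, ?_⟩
  rw [Lm_apply, Finset.sum_eq_single S]
  · simp
  · intro T _ hT
    rw [Pi.single_eq_of_ne hT, mul_zero]
  · intro h
    simp at h

lemma J_le_range {k : ℕ} (ω : Fin k → M) (r : ℕ) :
    J (Wsp R ω) r ≤ LinearMap.range (Lm (R := R) ω r) := by
  induction r with
  | zero =>
    intro x _
    have := mem_range_Lm (R := R) ω ∅ x
    simpa [wS] using this
  | succ r ih =>
    rw [J_succ]
    refine (mul_le_mul' le_rfl ih).trans ?_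
    rw [Wsp, Submodule.mul_le]
    intro m hm y hy
    induction hm using Submodule.span_induction with
    | mem m hm =>
      obtain ⟨i, rfl⟩ := hm
      obtain ⟨η, rfl⟩ := hy
      rw [Lm_apply, Finset.mul_sum]
      refine Submodule.sum_mem _ fun S hS => ?_
      have hc : S.card = r := (Finset.mem_powersetCard.mp hS).2
      by_cases hi : i ∈ S
      · simp only [← mul_assoc, ι_mul_wS' ω S i hi, zero_mul, Submodule.zero_mem]
      · have hm := mem_range_Lm (R := R) ω (insert i S) (η S)
        rw [Finset.card_insert_of_notMem hi, hc] at hm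
        simp only [← mul_assoc]
        rcases ι_mul_wS (R := R) ω S i hi with h | h <;> rw [h]
        · exact hm
        · rw [neg_mul]; exact neg_mem hm
    | zero => rw [zero_mul]; exact zero_mem _
    | add a b _ _ ha hb => rw [add_mul]; exact add_mem ha hb
    | smul c a _ ha => rw [smul_mul_assoc]; exact Submodule.smul_mem _ _ ha

lemma wS_mul_mem {k : ℕ} (ω : Fin k → M) {S : Finset (Fin k)} {r s : ℕ}
    (hS : S ∈ Finset.powersetCard r Finset.univ) {η : ExteriorAlgebra R M}
    (hη : η ∈ J (Wsp R ω) s) : wS R ω S * η ∈ J (Wsp R ω) (r + s) := by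
  rw [J, pow_add, mul_assoc]
  refine Submodule.mul_mem_mul ?_ hη
  have := wS_mem (R := R) ω S
  rwa [(Finset.mem_powersetCard.mp hS).2] at this

/-- multiply by the complement to isolate one coefficient -/
lemma isolate {k : ℕ} (ω : Fin k → M) (r : ℕ) (η : Finset (Fin k) → ExteriorAlgebra R M)
    {S : Finset (Fin k)} (hS : S ∈ Finset.powersetCard r Finset.univ) :
    wS R ω Sᶜ * Lm ω r η = wAll R ω * η S ∨ wS R ω Sᶜ * Lm ω r η = -(wAll R ω * η S) := by
  have : wS R ω Sᶜ * Lm ω r η = (wS R ω Sᶜ * wS R ω S) * η S := by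
    rw [Lm_apply, Finset.mul_sum, Finset.sum_eq_single S]
    · rw [mul_assoc]
    · intro T hT hne
      rw [← mul_assoc, wS_mul_disj, zero_mul]
      intro hd
      apply hne
      have hsub : T ⊆ S := by
        intro a ha
        by_contra hc
        exact Finset.disjoint_left.mp hd (Finset.mem_compl.mpr hc) ha
      refine Finset.eq_of_subset_of_card_le hsub ?_
      rw [(Finset.mem_powersetCard.mp hS).2, (Finset.mem_powersetCard.mp hT).2]
    · intro h; exact absurd hS h
  rw [this]
  rcases wS_mul_compl (R := R) ω S with h | h <;> rw [h] <;> simp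

/-- graded projection -/
noncomputable def pr (p : ℕ) : ExteriorAlgebra R M →ₗ[R] ExteriorAlgebra R M :=
  GradedAlgebra.proj (fun i : ℕ => ⋀[R]^i M) p

lemma pr_mem (p : ℕ) (x : ExteriorAlgebra R M) : pr p x ∈ ⋀[R]^p M := by
  rw [pr, GradedAlgebra.proj_apply]; exact SetLike.coe_mem _

lemma pr_of_mem {p : ℕ} {x : ExteriorAlgebra R M} (h : x ∈ ⋀[R]^p M) : pr p x = x := by
  rw [pr, GradedAlgebra.proj_apply]
  exact DirectSum.decompose_of_mem_same (fun i : ℕ => ⋀[R]^i M) h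

lemma pr_mul_le {r p : ℕ} {x : ExteriorAlgebra R M} (h : x ∈ ⋀[R]^r M) (hrp : r ≤ p)
    (y : ExteriorAlgebra R M) : pr p (x * y) = x * pr (p - r) y := by
  rw [pr, pr, GradedAlgebra.proj_apply, GradedAlgebra.proj_apply]
  exact DirectSum.coe_decompose_mul_of_left_mem_of_le (fun i : ℕ => ⋀[R]^i M) h hrp

lemma pr_mul_lt {r p : ℕ} {x : ExteriorAlgebra R M} (h : x ∈ ⋀[R]^r M) (hrp : ¬ r ≤ p)
    (y : ExteriorAlgebra R M) : pr p (x * y) = 0 := by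
  rw [pr, GradedAlgebra.proj_apply]
  exact DirectSum.coe_decompose_mul_of_left_mem_of_not_le (fun i : ℕ => ⋀[R]^i M) h hrp

lemma wS_mem_ext {k : ℕ} (ω : Fin k → M) {S : Finset (Fin k)} {r : ℕ}
    (hS : S ∈ Finset.powersetCard r Finset.univ) : wS R ω S ∈ ⋀[R]^r M := by
  have := wS_mem (R := R) ω S
  rw [(Finset.mem_powersetCard.mp hS).2] at this
  exact (pow_le_pow_left' (Wsp_le ω) r : _ ≤ _) this

lemma pr_Lm_le {k : ℕ} (ω : Fin k → M) {r p : ℕ} (h : r ≤ p)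
    (η : Finset (Fin k) → ExteriorAlgebra R M) :
    pr p (Lm ω r η) = Lm ω r (fun S => pr (p - r) (η S)) := by
  rw [Lm_apply, Lm_apply, map_sum]
  exact Finset.sum_congr rfl fun S hS => pr_mul_le (wS_mem_ext ω hS) h _

lemma pr_Lm_lt {k : ℕ} (ω : Fin k → M) {r p : ℕ} (h : ¬ r ≤ p)
    (η : Finset (Fin k) → ExteriorAlgebra R M) : pr p (Lm ω r η) = 0 := by
  rw [Lm_apply, map_sum]
  exact Finset.sum_eq_zero fun S hS => pr_mul_lt (wS_mem_ext ω hS) h _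

lemma mul_ι_comm (a : M) (p : ℕ) : ∀ z ∈ ⋀[R]^p M,
    z * ι R a = (-1 : R) ^ p • (ι R a * z) := by
  induction p with
  | zero =>
    intro z hz
    rw [exteriorPower, pow_zero, Submodule.mem_one] at hz
    obtain ⟨r, rfl⟩ := hz
    rw [pow_zero, one_smul, Algebra.commutes]
  | succ p ih =>
    intro z hz
    rw [exteriorPower, pow_succ'] at hz
    induction hz using Submodule.mul_induction_on' with
    | mem_mul_mem m hm y hy =>
      obtain ⟨b, rfl⟩ := hm
      rw [mul_assoc, ih y hy, mul_smul_comm, ← mul_assoc, ← mul_assoc,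
        eq_neg_of_add_eq_zero_left (ι_add_mul_swap (R := R) b a), pow_succ]
      simp
    | add x _ y _ hx hy => rw [add_mul, mul_add, smul_add, hx, hy]

lemma mul_list_comm {k : ℕ} (ω : Fin k → M) {p : ℕ} {z : ExteriorAlgebra R M}
    (hz : z ∈ ⋀[R]^p M) (l : List (Fin k)) :
    z * (l.map fun i => ι R (ω i)).prod =
      (-1 : R) ^ (p * l.length) • ((l.map fun i => ι R (ω i)).prod * z) := by
  induction l with
  | nil => simp
  | cons a l ih =>
    rw [List.map_cons, List.prod_cons, ← mul_assoc, mul_ι_comm _ _ _ hz, smul_mul_assoc,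
      mul_assoc, ih, mul_smul_comm, smul_smul, ← pow_add, List.length_cons, mul_assoc]
    congr 2
    ring

lemma wAll_comm {k : ℕ} (ω : Fin k → M) {p : ℕ} {z : ExteriorAlgebra R M}
    (hz : z ∈ ⋀[R]^p M) (h : z * wAll R ω = 0) : wAll R ω * z = 0 := by
  rw [wAll_eq] at h ⊢
  rw [mul_list_comm ω hz] at h
  exact (((isUnit_one.neg : IsUnit (-1 : R)).pow _).smul_eq_zero).mp h

end general

section coords
variable {R : Type*} [CommRing R] {n : ℕ}

lemma regular_smul_top {I : Ideal R} {b : R} (hb : ∀ x, b * x ∈ I → x ∈ I)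
    {z : ExteriorAlgebra R (Fin n → R)}
    (h : b • z ∈ I • (⊤ : Submodule R (ExteriorAlgebra R (Fin n → R)))) :
    z ∈ I • (⊤ : Submodule R (ExteriorAlgebra R (Fin n → R))) := by
  let B := (Pi.basisFun R (Fin n)).ExteriorAlgebra
  have key : ∀ s, B.repr z s ∈ I := by
    intro s
    apply hb
    have h1 : B.coord s (b • z) ∈ Submodule.map (B.coord s) (I • ⊤) := ⟨_, h, rfl⟩
    rw [Submodule.map_smul''] at h1
    have h2 : B.coord s (b • z) ∈ I • (⊤ : Submodule R R) := Submodule.smul_mono le_rfl le_top h1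
    simpa using h2
  rw [← B.sum_repr z]
  exact Submodule.sum_mem _ fun s _ => Submodule.smul_mem_smul (key s) trivial

lemma ann {k : ℕ} (ω : Fin k → (Fin n → R)) (I : Ideal R) {b : R} (hb : b ∈ Ideal.span
      (Set.range fun s : Fin k ↪o Fin n => Matrix.det (Matrix.of fun r c : Fin k => ω r (s c))))
    {z : ExteriorAlgebra R (Fin n → R)}
    (h : wAll R ω * z ∈ I • (⊤ : Submodule R (ExteriorAlgebra R (Fin n → R)))) :
    b • z ∈ J (Wsp R ω) 1 ⊔ I • (⊤ : Submodule R (ExteriorAlgebra R (Fin n → R))) := by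
  induction hb using Submodule.span_induction with
  | mem b hb =>
    obtain ⟨s, rfl⟩ := hb
    have hm : wAll R ω ∈ Wsp R ω ^ k := by
      have := list_mem (R := R) ω (List.finRange k)
      rwa [← wAll_eq, List.length_finRange] at this
    let d : Fin k → Module.Dual R (Fin n → R) := fun i => LinearMap.proj (s i)
    have h1 := ictr_mul (Wsp_le (R := R) ω) z k d (wAll R ω) hm
    have h2 := linmap_smul_top (ictr k d) I h
    have h3 : ictr k d (wAll R ω) * z =
        (Matrix.det (Matrix.of fun r c : Fin k => ω r (s c))) • z := by
      rw [wAll, ictr_ιMulti, ← Algebra.smul_def, ← Matrix.det_transpose]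
      rfl
    rw [h3] at h1
    have := sub_mem (Submodule.mem_sup_right h2) (Submodule.mem_sup_left h1)
    simpa using this
  | zero => rw [zero_smul]; exact zero_mem _
  | add a b _ _ ha hb => rw [add_smul]; exact add_mem ha hb
  | smul c a _ ha => rw [smul_assoc]; exact Submodule.smul_mem _ _ ha

/-- weak regularity modulo an ideal -/
def Reg : Ideal R → List R → Prop
  | _, [] => True
  | I, b :: rs => (∀ x, b * x ∈ I → x ∈ I) ∧ Reg (I ⊔ Ideal.span {b}) rs

lemma reg_of_append (suf : List R) : ∀ pre : List R,
    RingTheory.Sequence.IsWeaklyRegular R (pre ++ suf) → Reg (Ideal.ofList pre) suf := by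
  induction suf with
  | nil => intro _ _; trivial
  | cons b suf ih =>
    intro pre h
    refine ⟨?_, ?_⟩
    · have h1 := h.regular_mod_prev pre.length (by simp)
      simp only [List.take_left, List.getElem_append_right le_rfl, Nat.sub_self,
        List.getElem_cons_zero] at h1
      intro x hx
      have h2 := (isSMulRegular_quotient_iff_mem_of_smul_mem _ _).mp h1 x
      simpa using h2 (by simpa using hx)
    · have := ih (pre ++ [b]) (by simpa using h)
      simpa [Ideal.ofList_append] using this

lemma main {k : ℕ} (ω : Fin k → (Fin n → R)) : ∀ (p : ℕ) (I : Ideal R) (rs : List R),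
    p + 1 ≤ rs.length → (∀ x ∈ rs, x ∈ Ideal.span
      (Set.range fun s : Fin k ↪o Fin n => Matrix.det (Matrix.of fun r c : Fin k => ω r (s c)))) →
    Reg I rs → ∀ z ∈ ⋀[R]^p (Fin n → R),
    wAll R ω * z ∈ I • (⊤ : Submodule R (ExteriorAlgebra R (Fin n → R))) →
    z ∈ J (Wsp R ω) 1 ⊔ I • (⊤ : Submodule R (ExteriorAlgebra R (Fin n → R))) := by
  intro p
  induction p using Nat.strong_induction_on with
  | _ p IH =>
  intro I rs hlen hmem hreg z hz hzw
  match rs, hlen, hmem, hreg with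
  | [], hlen, _, _ => simp at hlen
  | b :: rs, hlen, hmem, hreg =>
  obtain ⟨hb, hreg⟩ := hreg
  have hlen' : p ≤ rs.length := by simpa using hlen
  have hmem' : ∀ x ∈ rs, _ := fun x hx => hmem x (List.mem_cons_of_mem _ hx)
  have claim : ∀ t r : ℕ, 1 ≤ r → r + t = p + 1 → ∀ z ∈ ⋀[R]^p (Fin n → R),
      b • z ∈ J (Wsp R ω) r ⊔ I • (⊤ : Submodule R (ExteriorAlgebra R (Fin n → R))) →
      z ∈ J (Wsp R ω) 1 ⊔ I • (⊤ : Submodule R (ExteriorAlgebra R (Fin n → R))) := by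
    intro t
    induction t with
    | zero =>
      intro r _ hr z hz h
      obtain ⟨j, hj, i, hi, hji⟩ := Submodule.mem_sup.mp h
      obtain ⟨η, rfl⟩ := J_le_range ω r hj
      have h1 := congrArg (pr p) hji
      rw [map_add, pr_Lm_lt ω (by omega), zero_add, map_smul, pr_of_mem hz] at h1
      exact Submodule.mem_sup_right (regular_smul_top hb (h1 ▸ linmap_smul_top (pr p) I hi))
    | succ t iht =>
      intro r hr1 hr z hz h
      have hrp : r ≤ p := by omega
      obtain ⟨j, hj, i, hi, hji⟩ := Submodule.mem_sup.mp h
      obtain ⟨η', rfl⟩ := J_le_range ω r hj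
      have h1 := congrArg (pr p) hji
      rw [map_add, pr_Lm_le ω hrp, map_smul, pr_of_mem hz] at h1
      replace hi := linmap_smul_top (pr p) I hi
      generalize pr p i = i' at h1 hi
      set η : Finset (Fin k) → ExteriorAlgebra R (Fin n → R) := fun S => pr (p - r) (η' S) with hη
      have hI' : (I ⊔ Ideal.span {b}) • (⊤ : Submodule R (ExteriorAlgebra R (Fin n → R))) =
          I • ⊤ ⊔ Ideal.span {b} • ⊤ := Submodule.sup_smul _ _ _
      have hL : Lm ω r η ∈ (I ⊔ Ideal.span {b}) •
          (⊤ : Submodule R (ExteriorAlgebra R (Fin n → R))) := by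
        rw [eq_sub_of_add_eq h1, hI']
        exact sub_mem (Submodule.mem_sup_right
          (Submodule.smul_mem_smul (Ideal.mem_span_singleton_self b) trivial))
          (Submodule.mem_sup_left hi)
      have step : ∀ S, ∃ ζ : ExteriorAlgebra R (Fin n → R),
          S ∈ Finset.powersetCard r Finset.univ → η S - b • ζ ∈ J (Wsp R ω) 1 ⊔
            I • (⊤ : Submodule R (ExteriorAlgebra R (Fin n → R))) := by
        intro S
        by_cases hS : S ∈ Finset.powersetCard r (Finset.univ : Finset (Fin k))
        swap
        · exact ⟨0, fun h => absurd h hS⟩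
        have hw : wAll R ω * η S ∈ (I ⊔ Ideal.span {b}) •
            (⊤ : Submodule R (ExteriorAlgebra R (Fin n → R))) := by
          have h2 := mul_smul_top _ (wS R ω Sᶜ) hL
          rcases isolate ω r η hS with h3 | h3
          · rwa [h3] at h2
          · rw [h3] at h2; simpa using neg_mem h2
        have h4 := IH (p - r) (by omega) _ rs (by omega) hmem' hreg (η S) (pr_mem _ _) hw
        rw [hI', ← sup_assoc] at h4
        obtain ⟨u, hu, v, hv, huv⟩ := Submodule.mem_sup.mp h4
        rw [Submodule.ideal_span_singleton_smul] at hv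
        obtain ⟨ζ, _, rfl⟩ := (Submodule.mem_smul_pointwise_iff_exists _ _ _).mp hv
        refine ⟨ζ, fun _ => ?_⟩
        rw [← huv, add_sub_cancel_right]
        exact hu
      choose ζ hζ using step
      have hJ : ∀ x, Lm ω r x ∈ J (Wsp R ω) 1 := by
        intro x
        rw [Lm_apply]
        refine Submodule.sum_mem _ fun S hS => ?_
        obtain ⟨r', rfl⟩ : ∃ r', r = 1 + r' := ⟨r - 1, by omega⟩
        have h5 := wS_mul_mem (R := R) (s := 0) (η := x S) ω hS (by rw [J_zero]; trivial)
        have h6 : J (Wsp R ω) (1 + r' + 0) ≤ J (Wsp R ω) 1 := by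
          have : Antitone (J (Wsp R ω)) := antitone_nat_of_succ_le (fun r => J_succ_le r)
          exact this (by omega)
        exact h6 h5
      have h7 : b • (z - Lm ω r ζ) ∈ J (Wsp R ω) (r + 1) ⊔
          I • (⊤ : Submodule R (ExteriorAlgebra R (Fin n → R))) := by
        have : b • (z - Lm ω r ζ) = Lm ω r (fun S => η S - b • ζ S) + i' := by
          have : (fun S => η S - b • ζ S) = η - b • ζ := rfl
          rw [this, map_sub, map_smul, smul_sub, ← h1]
          abel
        rw [this, Lm_apply]
        refine add_mem (Submodule.sum_mem _ fun S hS => ?_) (Submodule.mem_sup_right hi)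
        obtain ⟨u, hu, v, hv, huv⟩ := Submodule.mem_sup.mp (hζ S hS)
        rw [← huv, mul_add]
        exact add_mem (Submodule.mem_sup_left (wS_mul_mem ω hS hu))
          (Submodule.mem_sup_right (mul_smul_top _ _ hv))
      have h8 : b • (z - pr p (Lm ω r ζ)) ∈ J (Wsp R ω) (r + 1) ⊔
          I • (⊤ : Submodule R (ExteriorAlgebra R (Fin n → R))) := by
        obtain ⟨u, hu, v, hv, huv⟩ := Submodule.mem_sup.mp h7
        have h9 := congrArg (pr p) huv
        rw [map_add, map_smul, map_sub, pr_of_mem hz] at h9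
        rw [← h9]
        refine add_mem (Submodule.mem_sup_left ?_)
          (Submodule.mem_sup_right (linmap_smul_top _ _ hv))
        obtain ⟨x, rfl⟩ := J_le_range ω (r + 1) hu
        by_cases hle : r + 1 ≤ p
        · rw [pr_Lm_le ω hle, Lm_apply]
          exact Submodule.sum_mem _ fun S hS =>
            wS_mul_mem (s := 0) ω hS (by rw [J_zero]; trivial)
        · rw [pr_Lm_lt ω hle]; exact zero_mem _
      have h10 := iht (r + 1) (by omega) (by omega) _ (sub_mem hz (pr_mem _ _)) h8
      rw [pr_Lm_le ω hrp] at h10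
      have := add_mem h10 (Submodule.mem_sup_left (hJ (fun S => pr (p - r) (ζ S))))
      simpa using this
  exact claim p 1 le_rfl (by omega) z hz (ann ω I (hmem b (by simp)) hzw)

end coords
end SaitoAux

/-- Saito's generalized Koszul cohomology theorem (de Rham–Saito lemma), second part:
`H^p = 0` for all `p < depth_𝔞(R)`; here `p < depth_𝔞(R)` is witnessed by an `R`-regular
sequence of length `p + 1` contained in `𝔞`. Concretely, whenever `z ∈ Λ^p Ω` satisfies
`z ∧ ω₁ ∧ ⋯ ∧ ω_k = 0`, then `z ∈ Σᵢ ωᵢ ∧ Λ^{p-1} Ω`. -/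
theorem saito_koszul_part2 {R : Type*} [CommRing R] [IsNoetherianRing R]
    {n k : ℕ} (hk1 : 1 ≤ k) (hkn : k ≤ n) (ω : Fin k → (Fin n → R))
    (p : ℕ) (hpn : p ≤ n)
    (hdepth : ∃ rs : List R, rs.length = p + 1 ∧ (∀ x ∈ rs, x ∈ coeffIdeal ω) ∧
      RingTheory.Sequence.IsRegular R rs) :
    ∀ z ∈ extPow R n p, z * wedgeProd ω = 0 →
      ∃ ξ : Fin k → ExteriorAlgebra R (Fin n → R),
        (∀ i, ξ i ∈ extPow R n (p - 1)) ∧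
        z = ∑ i, ι R (ω i) * ξ i := by
  classical
  obtain ⟨rs, hlen, hmem, hreg⟩ := hdepth
  have hext : ∀ q, extPow R n q = ⋀[R]^q (Fin n → R) := by
    intro q
    rw [← ExteriorAlgebra.ιMulti_span_fixedDegree, extPow]
    congr 1
    ext x
    simp only [Set.mem_setOf_eq, Set.mem_range, ExteriorAlgebra.ιMulti_apply]
    exact ⟨fun ⟨v, h⟩ => ⟨v, h.symm⟩, fun ⟨v, h⟩ => ⟨v, h.symm⟩⟩
  intro z hz hzw
  rw [hext] at hz
  have hR : SaitoAux.Reg (⊥ : Ideal R) rs := by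
    have := SaitoAux.reg_of_append rs [] (by simpa using hreg.toIsWeaklyRegular)
    simpa using this
  have hm := SaitoAux.main ω p ⊥ rs hlen.ge hmem hR z hz
    (by
      rw [SaitoAux.wAll_comm ω hz hzw]
      exact zero_mem _)
  rw [Submodule.bot_smul, sup_bot_eq, SaitoAux.J, pow_one, SaitoAux.Wsp] at hm
  have hex : ∃ ξ : Fin k → ExteriorAlgebra R (Fin n → R), z = ∑ i, ι R (ω i) * ξ i := by
    clear hz hzw
    induction hm using Submodule.mul_induction_on' with
    | mem_mul_mem m hm y _ =>
      obtain ⟨c, rfl⟩ := (Submodule.mem_span_range_iff_exists_fun R).mp hm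
      exact ⟨fun i => c i • y, by simp [Finset.sum_mul]⟩
    | add x _ y _ hx hy =>
      obtain ⟨ξ, rfl⟩ := hx
      obtain ⟨ξ', rfl⟩ := hy
      exact ⟨fun i => ξ i + ξ' i, by simp [mul_add, Finset.sum_add_distrib]⟩
  obtain ⟨ξ, hξ⟩ := hex
  have hι : ∀ i, ι R (ω i) ∈ ⋀[R]^1 (Fin n → R) := by
    intro i
    rw [exteriorPower, pow_one]
    exact ⟨_, rfl⟩
  have h1 := congrArg (SaitoAux.pr p) hξ
  rw [SaitoAux.pr_of_mem hz, map_sum] at h1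
  by_cases hp : 1 ≤ p
  · refine ⟨fun i => SaitoAux.pr (p - 1) (ξ i), fun i => ?_, ?_⟩
    · rw [hext]; exact SaitoAux.pr_mem _ _
    · rw [h1]
      exact Finset.sum_congr rfl fun i _ => SaitoAux.pr_mul_le (hι i) hp _
  · refine ⟨fun _ => 0, fun i => zero_mem _, ?_⟩
    rw [h1]
    simp only [mul_zero, Finset.sum_const_zero]
    exact Finset.sum_eq_zero fun i _ => SaitoAux.pr_mul_lt (hι i) hp _
end

section
/- Let ψ : (ℂ^p, 0) → (ℂ^p, 0) be a finite holomorphic map germ with components ψ₁,…,ψ_p ∈ ℂ{y₁,…,y_p}. Then the Jacobian determinant J = det(∂ψᵢ/∂yⱼ) does not belong to the ideal of ℂ{y₁,…,y_p} generated by ψ₁,…,ψ_p. -/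
open Filter Topology

/-- The Jacobian determinant of a holomorphic map `ψ : ℂᵖ → ℂᵖ`. -/
noncomputable def jacobianDet {p : ℕ} (ψ : (Fin p → ℂ) → (Fin p → ℂ)) : (Fin p → ℂ) → ℂ :=
  fun y => Matrix.det (Matrix.of fun i j : Fin p =>
    fderiv ℂ (fun z => ψ z i) y (Pi.single j 1))

noncomputable def hvA {p : ℕ} (f : Fin p → (Fin p → ℂ) → ℂ) (y : Fin p → ℂ) :
    Matrix (Fin p) (Fin p) ℂ :=
  Matrix.of fun i k => fderiv ℂ (f i) y (Pi.single k 1)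

noncomputable def hvJ {p : ℕ} (f : Fin p → (Fin p → ℂ) → ℂ) (y : Fin p → ℂ) : ℂ :=
  (hvA f y).det

noncomputable def hvCof {p : ℕ} (f : Fin p → (Fin p → ℂ) → ℂ) (j k : Fin p)
    (y : Fin p → ℂ) : ℂ :=
  ((hvA f y).updateRow j (Pi.single k 1)).det

lemma hv_expand {p : ℕ} (M : Matrix (Fin p) (Fin p) ℂ) (j : Fin p) (c : Fin p → ℂ) :
    ∑ k, (M.updateRow j (Pi.single k 1)).det * c k = (M.updateRow j c).det := by
  have h : ∀ c, (M.updateRow j c).det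
      = (Matrix.detRowAlternating (n := Fin p) (R := ℂ)).toMultilinearMap.toLinearMap M j c := by
    intro c; rfl
  rw [h c]
  conv_rhs => rw [← Finset.univ_sum_single c]
  rw [map_sum]
  refine Finset.sum_congr rfl fun k _ => ?_
  rw [h, mul_comm, ← smul_eq_mul, ← map_smul]
  congr 1
  rw [← Pi.single_smul]; simp

lemma hv_cof_apply {p : ℕ} (f : Fin p → (Fin p → ℂ) → ℂ) (j : Fin p) (g : (Fin p → ℂ) → ℂ)
    (y : Fin p → ℂ) :
    ∑ k, hvCof f j k y * fderiv ℂ g y (Pi.single k 1) = hvJ (Function.update f j g) y := by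
  unfold hvCof
  rw [hv_expand (hvA f y) j (fun k => fderiv ℂ g y (Pi.single k 1))]
  unfold hvJ
  congr 1
  ext i k
  by_cases hi : i = j
  · subst hi; simp [hvA]
  · simp [hvA, hi]

lemma hv_cof_eq_zero {p : ℕ} (f : Fin p → (Fin p → ℂ) → ℂ) {i j : Fin p} (hij : i ≠ j)
    (y : Fin p → ℂ) : hvJ (Function.update f j (f i)) y = 0 := by
  apply Matrix.det_zero_of_row_eq hij
  ext k
  simp [hvA, hij]

lemma hv_antisymm {p : ℕ} (M : Matrix (Fin p) (Fin p) ℂ) {i j : Fin p} (hij : i ≠ j)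
    (H : Fin p → Fin p → ℂ) (hH : ∀ k l, H k l = H l k) :
    ∑ k, ((M.updateRow j (Pi.single k 1)).updateRow i (H k)).det = 0 := by
  have h1 : ∀ k, ((M.updateRow j (Pi.single k 1)).updateRow i (H k)).det
      = ∑ l, ((M.updateRow j (Pi.single k 1)).updateRow i (Pi.single l 1)).det * H k l :=
    fun k => (hv_expand _ _ _).symm
  simp_rw [h1]
  have h2 : ∀ k l, ((M.updateRow j (Pi.single k 1)).updateRow i (Pi.single l 1)).det
      = - ((M.updateRow j (Pi.single l 1)).updateRow i (Pi.single k 1)).det := by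
    intro k l
    have h3 := Matrix.det_permute' (n := Fin p) (R := ℂ) (Equiv.swap i j)
      ((M.updateRow j (Pi.single l 1)).updateRow i (Pi.single k 1))
    have h4 := Matrix.det_permute (n := Fin p) (R := ℂ) (Equiv.swap i j)
      ((M.updateRow j (Pi.single l 1)).updateRow i (Pi.single k 1))
    rw [Equiv.Perm.sign_swap hij] at h4
    have h5 : (((M.updateRow j (Pi.single l 1)).updateRow i (Pi.single k 1)).submatrix
        (Equiv.swap i j) id) = ((M.updateRow j (Pi.single k 1)).updateRow i (Pi.single l 1)) := by
      ext a b
      by_cases ha : a = i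
      · subst ha; simp [hij.symm]
      · by_cases hb : a = j
        · subst hb; simp [ha]
        · simp [ha, hb, Equiv.swap_apply_of_ne_of_ne]
    rw [h5] at h4
    rw [h4]; simp
  have key : ∑ k, ∑ l, ((M.updateRow j (Pi.single k 1)).updateRow i (Pi.single l 1)).det * H k l
     = - ∑ k, ∑ l, ((M.updateRow j (Pi.single k 1)).updateRow i (Pi.single l 1)).det * H k l := by
    conv_lhs => rw [Finset.sum_comm]
    rw [← Finset.sum_neg_distrib]
    refine Finset.sum_congr rfl fun k _ => ?_
    rw [← Finset.sum_neg_distrib]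
    refine Finset.sum_congr rfl fun l _ => ?_
    rw [h2, hH]; ring
  exact self_eq_neg.mp key

noncomputable def hvDet (p : ℕ) : ContinuousMultilinearMap ℂ (fun _ : Fin p => Fin p → ℂ) ℂ :=
  { (Matrix.detRowAlternating (n := Fin p) (R := ℂ)).toMultilinearMap with
    cont := by
      change Continuous (fun M : Matrix (Fin p) (Fin p) ℂ => M.det)
      exact continuous_id.matrix_det }

lemma hvDet_apply {p : ℕ} (M : Matrix (Fin p) (Fin p) ℂ) : hvDet p M = M.det := rfl

lemma hv_row_analytic {p : ℕ} {g : (Fin p → ℂ) → ℂ} {y : Fin p → ℂ} (hg : AnalyticAt ℂ g y) :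
    AnalyticAt ℂ (fun z => (fun k => fderiv ℂ g z (Pi.single k 1) : Fin p → ℂ)) y := by
  rw [analyticAt_pi_iff]
  intro k
  exact (ContinuousLinearMap.apply ℂ ℂ (Pi.single k 1 : Fin p → ℂ)).analyticAt _ |>.comp hg.fderiv

lemma hv_det_analytic {p : ℕ} {R : Fin p → (Fin p → ℂ) → (Fin p → ℂ)} {y : Fin p → ℂ}
    (hR : ∀ i, AnalyticAt ℂ (R i) y) :
    AnalyticAt ℂ (fun z => Matrix.det (Matrix.of fun i => R i z)) y := by
  have h1 : AnalyticAt ℂ (fun z => fun i => R i z) y := (analyticAt_pi_iff).2 hR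
  have h2 : AnalyticAt ℂ (hvDet p) ((fun z => fun i => R i z) y) := (hvDet p).analyticAt
  have h3 : AnalyticAt ℂ (fun z => hvDet p (fun i => R i z)) y := h2.comp h1
  exact h3

lemma hvJ_analytic {p : ℕ} {f : Fin p → (Fin p → ℂ) → ℂ} {y : Fin p → ℂ}
    (hf : ∀ i, AnalyticAt ℂ (f i) y) : AnalyticAt ℂ (hvJ f) y :=
  hv_det_analytic (R := fun i z => (fun k => fderiv ℂ (f i) z (Pi.single k 1)))
    (fun i => hv_row_analytic (hf i))

/-- rows of the cofactor matrix -/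
noncomputable def hvR {p : ℕ} (f : Fin p → (Fin p → ℂ) → ℂ) (j k : Fin p) :
    Fin p → (Fin p → ℂ) → (Fin p → ℂ) :=
  fun i z => if i = j then Pi.single k 1 else (fun l => fderiv ℂ (f i) z (Pi.single l 1))

lemma hvCof_eq {p : ℕ} (f : Fin p → (Fin p → ℂ) → ℂ) (j k : Fin p) :
    hvCof f j k = fun z => hvDet p (fun i => hvR f j k i z) := by
  funext z
  change _ = Matrix.det (Matrix.of fun i => hvR f j k i z)
  unfold hvCof
  congr 1
  ext i l
  by_cases hi : i = j
  · subst hi; simp [hvR]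
  · simp [hvR, hi, hvA]

lemma hvR_analytic {p : ℕ} {f : Fin p → (Fin p → ℂ) → ℂ} (j k : Fin p) {y : Fin p → ℂ}
    (hf : ∀ i, AnalyticAt ℂ (f i) y) (i : Fin p) : AnalyticAt ℂ (hvR f j k i) y := by
  unfold hvR
  by_cases hi : i = j
  · simp only [hi, if_true]; exact analyticAt_const
  · simp only [hi, if_false]; exact hv_row_analytic (hf i)

lemma hvCof_analytic {p : ℕ} {f : Fin p → (Fin p → ℂ) → ℂ} (j k : Fin p) {y : Fin p → ℂ}
    (hf : ∀ i, AnalyticAt ℂ (f i) y) : AnalyticAt ℂ (hvCof f j k) y := by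
  rw [hvCof_eq]
  exact hv_det_analytic (hvR_analytic j k hf)

/-- Piola identity -/
lemma hv_piola {p : ℕ} {f : Fin p → (Fin p → ℂ) → ℂ} (j : Fin p) {y : Fin p → ℂ}
    (hf : ∀ i, AnalyticAt ℂ (f i) y) :
    ∑ k, fderiv ℂ (hvCof f j k) y (Pi.single k 1) = 0 := by
  have h1 : ∀ k, fderiv ℂ (hvCof f j k) y (Pi.single k 1) =
      ∑ i, (((hvA f y).updateRow j (Pi.single k 1)).updateRow i
        (if i = j then 0 else
          fun l => fderiv ℂ (fderiv ℂ (f i)) y (Pi.single k 1) (Pi.single l 1))).det := by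
    intro k
    have hd := HasFDerivAt.multilinear_comp (hvDet p)
      (fun i => ((hvR_analytic j k hf) i).differentiableAt.hasFDerivAt)
    rw [hvCof_eq, hd.fderiv]
    rw [sum_apply]
    refine Finset.sum_congr rfl fun i _ => ?_
    rw [ContinuousLinearMap.comp_apply, ContinuousMultilinearMap.toContinuousLinearMap_apply]
    change Matrix.det _ = _
    congr 1
    have e1 : (fun i => hvR f j k i y) = (hvA f y).updateRow j (Pi.single k 1) := by
      ext i l
      by_cases hi : i = j
      · subst hi; simp [hvR]
      · simp [hvR, hi, hvA]
    rw [e1]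
    unfold Matrix.updateRow
    congr 1
    by_cases hi : i = j
    · have : hvR f j k i = fun _ => Pi.single k 1 := by funext z; simp [hvR, hi]
      rw [this]; simp [hi]
    · have : hvR f j k i = fun z l => fderiv ℂ (f i) z (Pi.single l 1) := by
        funext z; simp [hvR, hi]
      rw [this]; simp only [hi, if_false]
      funext l
      rw [fderiv_pi]
      · simp only [ContinuousLinearMap.pi_apply]
        rw [fderiv_clm_apply (hf i).fderiv.differentiableAt (by fun_prop)]
        simp
      · intro l
        exact (hf i).fderiv.differentiableAt.clm_apply (by fun_prop)
  simp_rw [h1]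
  rw [Finset.sum_comm]
  refine Finset.sum_eq_zero fun i _ => ?_
  by_cases hi : i = j
  · refine Finset.sum_eq_zero fun k _ => ?_
    simp only [hi, if_true]
    exact Matrix.det_eq_zero_of_row_eq_zero j (by simp)
  · simp only [hi, if_false]
    refine hv_antisymm (hvA f y) hi
      (fun k l => fderiv ℂ (fderiv ℂ (f i)) y (Pi.single k 1) (Pi.single l 1)) ?_
    intro k l
    exact ((hf i).contDiffAt (n := ⊤)).isSymmSndFDerivAt_of_omega _ _

/-- `u` is real differentiable at `y` with holomorphic (Wirtinger) differential `d`. -/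
def HvW {p : ℕ} (u : (Fin p → ℂ) → ℂ) (d : (Fin p → ℂ) → ℂ) (y : Fin p → ℂ) : Prop :=
  ∃ L : (Fin p → ℂ) →L[ℝ] ℂ, HasFDerivAt u L y ∧
    ∀ e, L e - Complex.I * L (Complex.I • e) = 2 * d e

lemma HvW.holo {p : ℕ} {g : (Fin p → ℂ) → ℂ} {y : Fin p → ℂ} (hg : AnalyticAt ℂ g y) :
    HvW g (fun e => fderiv ℂ g y e) y := by
  refine ⟨(fderiv ℂ g y).restrictScalars ℝ, hg.differentiableAt.hasFDerivAt.restrictScalars ℝ, ?_⟩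
  intro e
  simp only [ContinuousLinearMap.coe_restrictScalars', map_smul, smul_eq_mul, ← mul_assoc,
    Complex.I_mul_I]
  ring

lemma HvW.conj {p : ℕ} {g : (Fin p → ℂ) → ℂ} {y : Fin p → ℂ} (hg : AnalyticAt ℂ g y) :
    HvW (fun z => (starRingEnd ℂ) (g z)) (fun _ => 0) y := by
  refine ⟨(Complex.conjCLE : ℂ →L[ℝ] ℂ).comp ((fderiv ℂ g y).restrictScalars ℝ),
    ((Complex.conjCLE : ℂ →L[ℝ] ℂ).hasFDerivAt.comp y
      (hg.differentiableAt.hasFDerivAt.restrictScalars ℝ)), ?_⟩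
  intro e
  simp [← mul_assoc]

lemma HvW.mul {p : ℕ} {u v d d' : (Fin p → ℂ) → ℂ} {y : Fin p → ℂ}
    (hu : HvW u d y) (hv : HvW v d' y) :
    HvW (fun z => u z * v z) (fun e => u y * d' e + v y * d e) y := by
  obtain ⟨L, hL, h1⟩ := hu
  obtain ⟨M, hM, h2⟩ := hv
  refine ⟨_, hL.mul hM, ?_⟩
  intro e
  simp only [add_apply, smul_apply, smul_eq_mul]
  linear_combination (v y) * h1 e + (u y) * h2 e

lemma HvW.sum {p : ℕ} {ι : Type*} (s : Finset ι) {u d : ι → (Fin p → ℂ) → ℂ} {y : Fin p → ℂ}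
    (hu : ∀ i ∈ s, HvW (u i) (d i) y) :
    HvW (fun z => ∑ i ∈ s, u i z) (fun e => ∑ i ∈ s, d i e) y := by
  choose! L hL h using hu
  refine ⟨∑ i ∈ s, L i, HasFDerivAt.fun_sum hL, ?_⟩
  intro e
  simp only [sum_apply, Finset.mul_sum, ← Finset.sum_sub_distrib]
  exact Finset.sum_congr rfl fun i hi => h i hi e

lemma HvW.comp_real {p : ℕ} {N : (Fin p → ℂ) → ℝ} {d : (Fin p → ℂ) → ℂ} {y : Fin p → ℂ}
    (hN : HvW (fun z => (N z : ℂ)) d y) {X : ℝ → ℝ} {X' : ℝ} (hX : HasDerivAt X X' (N y)) :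
    HvW (fun z => (X (N z) : ℂ)) (fun e => X' * d e) y := by
  obtain ⟨L, hL, h⟩ := hN
  have hM : HasFDerivAt N (Complex.reCLM.comp L) y := by
    have := Complex.reCLM.hasFDerivAt.comp y hL
    exact this
  have hL' : HasFDerivAt (fun z => (N z : ℂ)) (Complex.ofRealCLM.comp (Complex.reCLM.comp L)) y :=
    Complex.ofRealCLM.hasFDerivAt.comp y hM
  have e1 := hL'.unique hL
  have hX2 := hX.comp_hasFDerivAt y hM
  have hX3 : HasFDerivAt (fun z => (X (N z) : ℂ))
    (Complex.ofRealCLM.comp (X' • Complex.reCLM.comp L)) y :=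
    Complex.ofRealCLM.hasFDerivAt.comp y hX2
  refine ⟨_, hX3, ?_⟩
  intro e
  have e2 : ∀ e, (((L e).re : ℝ) : ℂ) = L e := fun e => by
    have := congrArg (fun T => T e) e1
    simpa using this
  simp only [ContinuousLinearMap.comp_apply, smul_apply, smul_eq_mul,
    Complex.ofRealCLM_apply, Complex.reCLM_apply, Complex.ofReal_mul, e2]
  linear_combination (X' : ℂ) * h e

noncomputable def hvN {p : ℕ} (ψ : (Fin p → ℂ) → (Fin p → ℂ)) (y : Fin p → ℂ) : ℝ :=
  ∑ i, Complex.normSq (ψ y i)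

lemma hvN_coe {p : ℕ} (ψ : (Fin p → ℂ) → (Fin p → ℂ)) (y : Fin p → ℂ) :
    (hvN ψ y : ℂ) = ∑ i, ψ y i * (starRingEnd ℂ) (ψ y i) := by
  simp [hvN, Complex.mul_conj]

lemma HvW.normSq {p : ℕ} {ψ : (Fin p → ℂ) → (Fin p → ℂ)} {y : Fin p → ℂ}
    (hψ : ∀ i, AnalyticAt ℂ (fun z => ψ z i) y) :
    HvW (fun z => (hvN ψ z : ℂ))
      (fun e => ∑ i, (starRingEnd ℂ) (ψ y i) * fderiv ℂ (fun z => ψ z i) y e) y := by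
  have := HvW.sum (y := y) Finset.univ (u := fun i z => ψ z i * (starRingEnd ℂ) (ψ z i))
    (fun i _ => (HvW.holo (hψ i)).mul (HvW.conj (hψ i)))
  simp only [mul_zero, zero_add] at this
  simp_rw [hvN_coe]
  exact this

lemma hv_field {p : ℕ} {ψ : (Fin p → ℂ) → (Fin p → ℂ)} {y : Fin p → ℂ}
    (hψ : ∀ i, AnalyticAt ℂ (fun z => ψ z i) y)
    {f : Fin p → (Fin p → ℂ) → ℂ} (j : Fin p) (hf : ∀ i, AnalyticAt ℂ (f i) y)
    {g h : (Fin p → ℂ) → ℂ} (hg : AnalyticAt ℂ g y) (hh : AnalyticAt ℂ h y)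
    {X : ℝ → ℝ} {X' : ℝ} (hX : HasDerivAt X X' (hvN ψ y)) :
    ∃ d : Fin p → (Fin p → ℂ) → ℂ,
      (∀ k, HvW (fun z => hvCof f j k z *
        ((X (hvN ψ z) : ℂ) * (g z * (starRingEnd ℂ) (h z)))) (d k) y) ∧
      ∑ k, d k (Pi.single k 1) =
        X (hvN ψ y) * hvJ (Function.update f j g) y * (starRingEnd ℂ) (h y) +
        X' * (∑ i, (starRingEnd ℂ) (ψ y i) * hvJ (Function.update f j (fun z => ψ z i)) y)
          * (g y * (starRingEnd ℂ) (h y)) := by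
  refine ⟨_, fun k => (HvW.holo (hvCof_analytic j k hf)).mul
    (((HvW.normSq hψ).comp_real hX).mul ((HvW.holo hg).mul (HvW.conj hh))), ?_⟩
  simp only [← hv_cof_apply, mul_zero, zero_add]
  have hp := hv_piola j hf
  rw [Finset.sum_add_distrib, ← Finset.mul_sum, hp, mul_zero, add_zero]
  simp only [mul_add, Finset.sum_add_distrib, Finset.mul_sum, Finset.sum_mul]
  congr 1
  · exact Finset.sum_congr rfl fun k _ => by ring
  · rw [Finset.sum_comm]
    exact Finset.sum_congr rfl fun k _ => Finset.sum_congr rfl fun i _ => by ring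

open MeasureTheory in
lemma hv_integral {p : ℕ} {B K : Set (Fin p → ℂ)} (hB : IsOpen B) (hK : IsCompact K)
    (hKB : K ⊆ B) (W : Fin p → (Fin p → ℂ) → ℂ) (hW : ∀ k, ContDiffOn ℝ 1 (W k) B)
    (hW0 : ∀ k, ∀ y ∈ B, y ∉ K → W k y = 0) (G : (Fin p → ℂ) → ℝ) (hG : ∀ y ∈ B, 0 ≤ G y)
    (hd : ∀ y ∈ B, ∃ d : Fin p → (Fin p → ℂ) → ℂ, (∀ k, HvW (W k) (d k) y) ∧
      ∑ k, d k (Pi.single k 1) = G y) :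
    ∀ y ∈ B, G y = 0 := by
  set V : Fin p → (Fin p → ℂ) → ℂ := fun k => B.indicator (W k) with hV
  have hVB : ∀ k, ∀ y ∈ B, V k =ᶠ[𝓝 y] W k := fun k y hy => by
    filter_upwards [hB.mem_nhds hy] with z hz
    simp [hV, hz]
  have hVK : ∀ k, ∀ y ∉ K, V k y = 0 := fun k y hy => by
    by_cases hyB : y ∈ B
    · simp only [hV, Set.indicator_of_mem hyB]; exact hW0 k y hyB hy
    · simp [hV, hyB]
  have hVc : ∀ k, ContDiff ℝ 1 (V k) := fun k => by
    rw [contDiff_iff_contDiffAt]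
    intro y
    by_cases hy : y ∈ B
    · exact ((hW k).contDiffAt (hB.mem_nhds hy)).congr_of_eventuallyEq (hVB k y hy)
    · have : V k =ᶠ[𝓝 y] fun _ => 0 := by
        filter_upwards [hK.isClosed.isOpen_compl.mem_nhds (fun h => hy (hKB h))] with z hz
        exact hVK k z hz
      exact contDiffAt_const.congr_of_eventuallyEq this
  have hVs : ∀ k, HasCompactSupport (V k) := fun k => HasCompactSupport.intro hK (hVK k)
  have hc : ∀ k e, Continuous (fun y => fderiv ℝ (V k) y e) := fun k e =>
    ((hVc k).continuous_fderiv (by norm_num)).clm_apply continuous_const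
  have hcs : ∀ k e, HasCompactSupport (fun y => fderiv ℝ (V k) y e) := fun k e =>
    (hVs k).fderiv_apply (𝕜 := ℝ) e
  have hi : ∀ k e, Integrable (fun y => fderiv ℝ (V k) y e) := fun k e =>
    (hc k e).integrable_of_hasCompactSupport (hcs k e)
  have h0 : ∀ k e, ∫ y, fderiv ℝ (V k) y e = 0 := fun k e => by
    have := integral_mul_fderiv_eq_neg_fderiv_mul_of_integrable (μ := (volume : Measure (Fin p → ℂ)))
      (𝕜 := ℂ) (f := fun _ => (1 : ℂ)) (g := V k) (v := e) (by simp) (by simpa using hi k e)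
      (by simpa using (hVc k).continuous.integrable_of_hasCompactSupport (hVs k))
      (fun _ _ => by fun_prop)
      (fun x _ => ((hVc k).differentiable (by norm_num)) x)
    simpa using this
  set T : (Fin p → ℂ) → ℂ := fun y => ∑ k, (fderiv ℝ (V k) y (Pi.single k 1)
    - Complex.I * fderiv ℝ (V k) y (Complex.I • Pi.single k 1)) with hT
  have hTc : Continuous T := by
    refine continuous_finsetSum _ fun k _ => (hc _ _).sub (continuous_const.mul (hc _ _))
  have hTi : Integrable T := by
    refine integrable_finsetSum _ fun k _ => (hi _ _).sub ((hi _ _).const_mul _)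
  have hT0 : ∫ y, T y = 0 := by
    have hk : ∀ k ∈ (Finset.univ : Finset (Fin p)),
        Integrable (fun y => fderiv ℝ (V k) y (Pi.single k 1)
          - Complex.I * fderiv ℝ (V k) y (Complex.I • Pi.single k 1)) :=
      fun k _ => (hi _ _).sub ((hi _ _).const_mul _)
    simp only [hT]
    rw [integral_finsetSum _ hk]
    refine Finset.sum_eq_zero fun k _ => ?_
    rw [integral_sub (hi _ _) ((hi _ _).const_mul _), integral_const_mul, h0, h0]
    simp
  have hTB : ∀ y ∈ B, T y = 2 * G y := by
    intro y hy
    obtain ⟨d, hd1, hd2⟩ := hd y hy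
    rw [← hd2, Finset.mul_sum]
    refine Finset.sum_congr rfl fun k _ => ?_
    obtain ⟨L, hL, h⟩ := hd1 k
    rw [(hVB k y hy).fderiv_eq, hL.fderiv, h]
  have hTn : ∀ y ∉ B, T y = 0 := by
    intro y hy
    refine Finset.sum_eq_zero fun k _ => ?_
    have : V k =ᶠ[𝓝 y] fun _ => 0 := by
      filter_upwards [hK.isClosed.isOpen_compl.mem_nhds (fun h => hy (hKB h))] with z hz
      exact hVK k z hz
    rw [this.fderiv_eq]; simp
  have hre0 : ∫ y, (T y).re = 0 := by
    have := integral_re (𝕜 := ℂ) hTi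
    simp only [RCLike.re_eq_complex_re] at this
    rw [this, hT0]; simp
  have hnn : 0 ≤ fun y => (T y).re := by
    intro y
    by_cases hy : y ∈ B
    · simp only [hTB y hy]
      have := hG y hy
      simpa using this
    · simp [hTn y hy]
  have hae := (integral_eq_zero_iff_of_nonneg hnn hTi.re).1 hre0
  have hz := (Continuous.ae_eq_iff_eq volume (Complex.continuous_re.comp hTc) continuous_zero).1 hae
  intro y hy
  have h3 := congrFun hz y
  simp only [Function.comp, hTB y hy] at h3
  simpa using h3

lemma hv_setup {p : ℕ} {ψ : (Fin p → ℂ) → (Fin p → ℂ)}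
    (hψ : AnalyticAt ℂ ψ 0)
    (hfin : ∀ᶠ y in 𝓝 (0 : Fin p → ℂ), ψ y = 0 → y = 0) {P : (Fin p → ℂ) → Prop}
    (hP : ∀ᶠ y in 𝓝 (0 : Fin p → ℂ), P y) :
    ∃ B K : Set (Fin p → ℂ), IsOpen B ∧ IsCompact K ∧ K ⊆ B ∧ (0 : Fin p → ℂ) ∈ B ∧
      (∀ y ∈ B, P y) ∧ ∃ δ : ℝ, 0 < δ ∧ ∀ y ∈ B, y ∉ K → δ ≤ hvN ψ y := by
  have hev := (hP.and hfin).and hψ.eventually_analyticAt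
  obtain ⟨r, hr, hrP⟩ := Metric.nhds_basis_closedBall.eventually_iff.1 hev
  have hNc : ContinuousOn (hvN ψ) (Metric.closedBall 0 r) := by
    have h1 : ContinuousOn ψ (Metric.closedBall 0 r) := fun y hy =>
      (hrP hy).2.continuousAt.continuousWithinAt
    unfold hvN
    refine continuousOn_finsetSum _ fun i _ => ?_
    exact Complex.continuous_normSq.comp_continuousOn ((continuous_apply i).comp_continuousOn h1)
  have hs : IsCompact (Metric.sphere (0 : Fin p → ℂ) r) := isCompact_sphere _ _
  obtain ⟨ε, hε, hεs⟩ := hs.exists_forall_le' (hNc.mono Metric.sphere_subset_closedBall) (a := 0) (by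
    intro y hy
    have hy0 : ψ y ≠ 0 := fun h => by
      have := (hrP (Metric.sphere_subset_closedBall hy)).1.2 h
      subst this
      simp at hy
      exact hr.ne hy
    obtain ⟨i, hi⟩ := Function.ne_iff.1 hy0
    exact Finset.sum_pos' (fun i _ => Complex.normSq_nonneg _) ⟨i, Finset.mem_univ _,
      Complex.normSq_pos.2 hi⟩)
  refine ⟨Metric.ball 0 r, Metric.closedBall 0 r ∩ hvN ψ ⁻¹' Set.Iic (ε / 2), Metric.isOpen_ball,
    ?_, ?_, Metric.mem_ball_self hr, fun y hy => (hrP (Metric.ball_subset_closedBall hy)).1.1,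
    ε / 2, by positivity, ?_⟩
  · exact (isCompact_closedBall _ _).of_isClosed_subset
      (hNc.preimage_isClosed_of_isClosed Metric.isClosed_closedBall isClosed_Iic)
      Set.inter_subset_left
  · rintro y ⟨hy, hy2⟩
    rcases (Metric.mem_closedBall.1 hy).lt_or_eq with h | h
    · exact h
    · have := hεs y h
      simp only [Set.mem_preimage, Set.mem_Iic] at hy2
      linarith
  · intro y hy hyK
    by_contra hlt
    exact hyK ⟨Metric.ball_subset_closedBall hy, (not_le.1 hlt).le⟩

noncomputable def hvX (δ t : ℝ) : ℝ := (max (δ - t) 0) ^ 2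

lemma hvX_deriv (δ t : ℝ) : HasDerivAt (hvX δ) (-2 * max (δ - t) 0) t := by
  rcases lt_trichotomy t δ with h | h | h
  · have h1 : hvX δ =ᶠ[𝓝 t] fun s => (δ - s) ^ 2 := by
      filter_upwards [Iio_mem_nhds h] with s hs
      simp only [Set.mem_Iio] at hs
      simp [hvX, max_eq_left (sub_nonneg.2 hs.le)]
    rw [max_eq_left (sub_nonneg.2 h.le)]
    refine HasDerivAt.congr_of_eventuallyEq ?_ h1
    have := ((hasDerivAt_id t).const_sub δ).pow 2
    convert! this using 1
    simp
  · subst h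
    simp only [sub_self, max_self, mul_zero]
    rw [hasDerivAt_iff_isLittleO]
    simp only [hvX, sub_self, max_self, smul_zero, sub_zero]
    have : (fun s : ℝ => (max (t - s) 0) ^ 2 - 0 ^ 2) =O[𝓝 t] fun s => ‖s - t‖ ^ 2 := by
      refine Asymptotics.IsBigO.of_bound 1 (Filter.Eventually.of_forall fun s => ?_)
      rw [one_mul]
      simp only [ne_eq, OfNat.ofNat_ne_zero, not_false_eq_true, zero_pow, sub_zero, norm_pow, norm_norm]
      gcongr
      rw [Real.norm_eq_abs, Real.norm_eq_abs, abs_of_nonneg (le_max_right _ _), abs_sub_comm]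
      exact max_le (le_abs_self _) (abs_nonneg _)
    exact this.trans_isLittleO (Asymptotics.isLittleO_pow_sub_sub t (m := 2) (by norm_num))
  · have h1 : hvX δ =ᶠ[𝓝 t] fun s => 0 := by
      filter_upwards [Ioi_mem_nhds h] with s hs
      simp only [Set.mem_Ioi] at hs
      simp [hvX, max_eq_right (sub_nonpos.2 hs.le)]
    rw [max_eq_right (sub_nonpos.2 h.le), mul_zero]
    exact (hasDerivAt_const t (0 : ℝ)).congr_of_eventuallyEq h1

lemma hvX_contDiff (δ : ℝ) : ContDiff ℝ 1 (hvX δ) := by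
  rw [contDiff_one_iff_deriv]
  refine ⟨fun t => (hvX_deriv δ t).differentiableAt, ?_⟩
  have : deriv (hvX δ) = fun t => -2 * max (δ - t) 0 := funext fun t => (hvX_deriv δ t).deriv
  rw [this]; fun_prop

lemma hvX_zero {δ t : ℝ} (h : δ ≤ t) : hvX δ t = 0 := by
  simp [hvX, max_eq_right (sub_nonpos.2 h)]

lemma hv_analytic_real {p : ℕ} {g : (Fin p → ℂ) → ℂ} {B : Set (Fin p → ℂ)}
    (hg : ∀ y ∈ B, AnalyticAt ℂ g y) : ContDiffOn ℝ 1 g B := fun y hy =>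
  ((hg y hy).contDiffAt.restrict_scalars ℝ).contDiffWithinAt

lemma hv_smooth {p : ℕ} {ψ : (Fin p → ℂ) → (Fin p → ℂ)} {B : Set (Fin p → ℂ)} (δ : ℝ)
    (hψ : ∀ y ∈ B, ∀ i, AnalyticAt ℂ (fun z => ψ z i) y)
    {f : Fin p → (Fin p → ℂ) → ℂ} (j k : Fin p) (hf : ∀ y ∈ B, ∀ i, AnalyticAt ℂ (f i) y)
    {g h : (Fin p → ℂ) → ℂ} (hg : ∀ y ∈ B, AnalyticAt ℂ g y) (hh : ∀ y ∈ B, AnalyticAt ℂ h y) :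
    ContDiffOn ℝ 1 (fun z => hvCof f j k z *
        ((hvX δ (hvN ψ z) : ℂ) * (g z * (starRingEnd ℂ) (h z)))) B := by
  have hN : ContDiffOn ℝ 1 (hvN ψ) B := by
    have h1 : ContDiffOn ℝ 1 (fun z => (hvN ψ z : ℂ)) B := by
      simp_rw [hvN_coe]
      refine ContDiffOn.sum fun i _ => ?_
      have h2 := hv_analytic_real (fun y hy => hψ y hy i)
      exact h2.mul (Complex.conjCLE.contDiff.comp_contDiffOn h2)
    exact Complex.reCLM.contDiff.comp_contDiffOn h1
  refine (hv_analytic_real fun y hy => hvCof_analytic j k (hf y hy)).mul (ContDiffOn.mul ?_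
    ((hv_analytic_real hg).mul (Complex.conjCLE.contDiff.comp_contDiffOn (hv_analytic_real hh))))
  exact Complex.ofRealCLM.contDiff.comp_contDiffOn ((hvX_contDiff δ).comp_contDiffOn hN)

lemma hv_near {p : ℕ} {ψ : (Fin p → ℂ) → (Fin p → ℂ)}
    (hψ : AnalyticAt ℂ ψ 0) (hψ0 : ψ 0 = 0) {δ : ℝ} (hδ : 0 < δ) :
    ∀ᶠ y in 𝓝 0, hvN ψ y < δ := by
  have h1 : ContinuousAt (hvN ψ) 0 := by
    unfold hvN
    refine tendsto_finsetSum _ fun i _ => ?_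
    exact Complex.continuous_normSq.continuousAt.comp
      ((continuous_apply i).continuousAt.comp hψ.continuousAt)
  refine h1.eventually_lt continuousAt_const ?_
  simpa [hvN, hψ0] using hδ

lemma hv_comp_analytic {p : ℕ} {ψ : (Fin p → ℂ) → (Fin p → ℂ)} {y : Fin p → ℂ}
    (hψ : AnalyticAt ℂ ψ y) (i : Fin p) : AnalyticAt ℂ (fun z => ψ z i) y :=
  (analyticAt_pi_iff.1 hψ) i

lemma hv_step2 {p : ℕ} {ψ : (Fin p → ℂ) → (Fin p → ℂ)}
    (hψ : AnalyticAt ℂ ψ 0) (hψ0 : ψ 0 = 0)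
    (hfin : ∀ᶠ y in 𝓝 (0 : Fin p → ℂ), ψ y = 0 → y = 0)
    (f : Fin p → (Fin p → ℂ) → ℂ) (j : Fin p) (hf : ∀ i, AnalyticAt ℂ (f i) 0)
    (hz : ∀ i, ∀ᶠ y in 𝓝 0, hvJ (Function.update f j (fun z => ψ z i)) y = 0) :
    ∀ᶠ y in 𝓝 0, hvJ f y = 0 := by
  obtain ⟨B, K, hB, hK, hKB, h0B, hP, δ, hδ, hδK⟩ := hv_setup hψ hfin
    (((eventually_all.2 hz).and hψ.eventually_analyticAt).and
      (eventually_all.2 fun i => (hf i).eventually_analyticAt))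
  have hψB : ∀ y ∈ B, ∀ i, AnalyticAt ℂ (fun z => ψ z i) y :=
    fun y hy i => hv_comp_analytic (hP y hy).1.2 i
  have hfB : ∀ y ∈ B, ∀ i, AnalyticAt ℂ (f i) y := fun y hy => (hP y hy).2
  have hJB : ∀ y ∈ B, AnalyticAt ℂ (hvJ f) y := fun y hy => hvJ_analytic (hfB y hy)
  have key := hv_integral hB hK hKB (fun k z => hvCof f j k z *
        ((hvX δ (hvN ψ z) : ℂ) * (f j z * (starRingEnd ℂ) (hvJ f z))))
    (fun k => hv_smooth δ hψB j k hfB (fun y hy => hfB y hy j) hJB)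
    (fun k y hy hyK => by simp [hvX_zero (hδK y hy hyK)])
    (fun y => hvX δ (hvN ψ y) * Complex.normSq (hvJ f y))
    (fun y _ => mul_nonneg (sq_nonneg _) (Complex.normSq_nonneg _))
    (fun y hy => by
      obtain ⟨d, hd, he⟩ := hv_field (hψB y hy) j (hfB y hy) (hfB y hy j) (hJB y hy)
        (hvX_deriv δ (hvN ψ y))
      refine ⟨d, hd, ?_⟩
      rw [he]
      simp only [(hP y hy).1.1, Function.update_eq_self, mul_zero, Finset.sum_const_zero, zero_mul,
        add_zero, Complex.ofReal_mul, ← Complex.mul_conj]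
      ring)
  filter_upwards [hB.mem_nhds h0B, hv_near hψ hψ0 hδ] with y hy hN
  rcases mul_eq_zero.1 (key y hy) with h | h
  · exfalso
    simp only [hvX, max_eq_left (sub_nonneg.2 hN.le)] at h
    have := pow_eq_zero_iff (two_ne_zero) |>.1 h
    linarith
  · exact Complex.normSq_eq_zero.1 h

lemma hv_step1 {p : ℕ} {ψ : (Fin p → ℂ) → (Fin p → ℂ)}
    (hψ : AnalyticAt ℂ ψ 0) (hψ0 : ψ 0 = 0)
    (hfin : ∀ᶠ y in 𝓝 (0 : Fin p → ℂ), ψ y = 0 → y = 0)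
    (h : Fin p → (Fin p → ℂ) → ℂ) (hh : ∀ i, AnalyticAt ℂ (h i) 0)
    (hJ : ∀ᶠ y in 𝓝 0, hvJ (fun i z => ψ z i) y = ∑ i, h i y * ψ y i) :
    ∀ᶠ y in 𝓝 0, hvJ (fun i z => ψ z i) y = 0 := by
  obtain ⟨B, K, hB, hK, hKB, h0B, hP, δ, hδ, hδK⟩ := hv_setup hψ hfin
    ((hJ.and hψ.eventually_analyticAt).and
      (eventually_all.2 fun i => (hh i).eventually_analyticAt))
  have hψB : ∀ y ∈ B, ∀ i, AnalyticAt ℂ (fun z => ψ z i) y :=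
    fun y hy i => hv_comp_analytic (hP y hy).1.2 i
  have hhB : ∀ y ∈ B, ∀ i, AnalyticAt ℂ (h i) y := fun y hy => (hP y hy).2
  have key := hv_integral hB hK hKB (fun k z => ∑ j, hvCof (fun i z => ψ z i) j k z *
        ((hvX δ (hvN ψ z) : ℂ) * ((fun _ => (-1 : ℂ)) z * (starRingEnd ℂ) (h j z))))
    (fun k => ContDiffOn.sum fun j _ =>
      hv_smooth δ hψB j k hψB (fun y hy => analyticAt_const) (fun y hy => hhB y hy j))
    (fun k y hy hyK => by simp [hvX_zero (hδK y hy hyK)])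
    (fun y => 2 * max (δ - hvN ψ y) 0 * Complex.normSq (hvJ (fun i z => ψ z i) y))
    (fun y _ => mul_nonneg (mul_nonneg zero_le_two (le_max_right _ _)) (Complex.normSq_nonneg _))
    (fun y hy => by
      have hd : ∀ j, _ := fun j => hv_field (hψB y hy) j (hψB y hy)
        (analyticAt_const (v := (-1 : ℂ))) (hhB y hy j) (hvX_deriv δ (hvN ψ y))
      choose d hd he using hd
      refine ⟨fun k e => ∑ j, d j k e, fun k => HvW.sum _ fun j _ => hd j k, ?_⟩
      rw [Finset.sum_comm]
      have e1 : ∀ j, hvJ (Function.update (fun i z => ψ z i) j (fun _ => (-1 : ℂ))) y = 0 := by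
        intro j
        apply Matrix.det_eq_zero_of_row_eq_zero j
        intro k
        simp [hvA]
      have e2 : ∀ j, ∑ i, (starRingEnd ℂ) (ψ y i) *
          hvJ (Function.update (fun i z => ψ z i) j (fun z => ψ z i)) y
          = (starRingEnd ℂ) (ψ y j) * hvJ (fun i z => ψ z i) y := by
        intro j
        rw [Finset.sum_eq_single j]
        · rw [Function.update_eq_self j (fun i z => ψ z i)]
        · intro i _ hi
          rw [hv_cof_eq_zero (fun i z => ψ z i) hi, mul_zero]
        · simp
      simp only [he, e1, e2]
      have e3 : (starRingEnd ℂ) (hvJ (fun i z => ψ z i) y)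
          = ∑ j, (starRingEnd ℂ) (h j y) * (starRingEnd ℂ) (ψ y j) := by
        rw [(hP y hy).1.1]; simp
      simp only [Complex.ofReal_mul, ← Complex.mul_conj, e3, Finset.mul_sum]
      refine Finset.sum_congr rfl fun j _ => ?_
      push_cast
      ring)
  filter_upwards [hB.mem_nhds h0B, hv_near hψ hψ0 hδ] with y hy hN
  rcases mul_eq_zero.1 (key y hy) with h | h
  · exfalso
    rw [max_eq_left (sub_nonneg.2 hN.le)] at h
    linarith
  · exact Complex.normSq_eq_zero.1 h

lemma hv_step3 {p : ℕ} {ψ : (Fin p → ℂ) → (Fin p → ℂ)}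
    (hψ : AnalyticAt ℂ ψ 0) (hψ0 : ψ 0 = 0)
    (hfin : ∀ᶠ y in 𝓝 (0 : Fin p → ℂ), ψ y = 0 → y = 0)
    (hJ : ∀ᶠ y in 𝓝 0, hvJ (fun i z => ψ z i) y = 0) : False := by
  set F : Fin p ⊕ Fin p → (Fin p → ℂ) → ℂ :=
    Sum.elim (fun a z => ψ z a) (fun m z => z m) with hF
  have hFa : ∀ s, AnalyticAt ℂ (F s) 0 := by
    rintro (a | m)
    · exact hv_comp_analytic hψ a
    · exact (ContinuousLinearMap.proj (R := ℂ) (φ := fun _ : Fin p => ℂ) m).analyticAt 0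
  have claim : ∀ n : ℕ, ∀ c : Fin p → Fin p ⊕ Fin p,
      (Finset.univ.filter fun i => (c i).isRight).card = n →
      ∀ᶠ y in 𝓝 0, hvJ (fun i => F (c i)) y = 0 := by
    intro n
    induction n with
    | zero =>
      intro c hc
      rw [Finset.card_eq_zero, Finset.filter_eq_empty_iff] at hc
      have : ∀ i, ∃ a, c i = Sum.inl a := fun i => by
        have := hc (Finset.mem_univ i)
        rcases h : c i with a | m
        · exact ⟨a, rfl⟩
        · simp [h] at this
      choose a ha using this
      filter_upwards [hJ] with y hy
      have e : hvA (fun i => F (c i)) y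
          = (1 : Matrix (Fin p) (Fin p) ℂ).submatrix a id * hvA (fun i z => ψ z i) y := by
        ext i k
        simp [hvA, ha, hF, Matrix.mul_apply, Matrix.one_apply]
      unfold hvJ at hy ⊢
      rw [e, Matrix.det_mul, hy, mul_zero]
    | succ n ih =>
      intro c hc
      have hne : (Finset.univ.filter fun i => (c i).isRight).Nonempty := by
        rw [← Finset.card_pos]; omega
      obtain ⟨j, hj⟩ := hne
      refine hv_step2 hψ hψ0 hfin (fun i => F (c i)) j (fun i => hFa _) ?_
      intro i
      have h1 := ih (Function.update c j (Sum.inl i)) (by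
        have : (Finset.univ.filter fun l => (Function.update c j (Sum.inl i) l).isRight)
            = (Finset.univ.filter fun i => (c i).isRight).erase j := by
          ext l
          by_cases hl : l = j
          · subst hl; simp
          · simp [hl]
        rw [this, Finset.card_erase_of_mem hj, hc]; rfl)
      have e : (fun l => F (Function.update c j (Sum.inl i) l))
          = Function.update (fun i => F (c i)) j (fun z => ψ z i) := by
        funext l
        by_cases hl : l = j
        · subst hl; simp [hF]
        · simp [hl]
      rwa [e] at h1
  have h1 := (claim _ (fun i => Sum.inr i) rfl).self_of_nhds
  have e : hvA (fun i => F (Sum.inr i)) (0 : Fin p → ℂ) = 1 := by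
    ext i k
    have : fderiv ℂ (fun z : Fin p → ℂ => z i) 0
        = ContinuousLinearMap.proj (R := ℂ) (φ := fun _ : Fin p => ℂ) i :=
      (ContinuousLinearMap.proj (R := ℂ) (φ := fun _ : Fin p => ℂ) i).fderiv
    simp [hvA, hF, this, Matrix.one_apply, Pi.single_apply]
  unfold hvJ at h1
  rw [e] at h1
  simp at h1



/-- Hovansky's theorem: for a finite holomorphic map germ `ψ : (ℂᵖ,0) → (ℂᵖ,0)`
(finiteness being expressed by `0` being an isolated point of the fiber `ψ⁻¹(0)`),
the Jacobian determinant `J = det(∂ψᵢ/∂yⱼ)` does not belong to the ideal of `ℂ{y}`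
generated by the components `ψ₁, …, ψ_p`: there is no identity
`J = Σᵢ hᵢ ψᵢ` with `hᵢ` holomorphic near `0`. -/
theorem jacobian_not_in_ideal {p : ℕ} (ψ : (Fin p → ℂ) → (Fin p → ℂ))
    (hψ : AnalyticAt ℂ ψ 0) (hψ0 : ψ 0 = 0)
    (hfin : ∀ᶠ y in 𝓝 (0 : Fin p → ℂ), ψ y = 0 → y = 0) :
    ¬ ∃ h : Fin p → ((Fin p → ℂ) → ℂ), (∀ i, AnalyticAt ℂ (h i) 0) ∧
      ∀ᶠ y in 𝓝 (0 : Fin p → ℂ), jacobianDet ψ y = ∑ i, h i y * ψ y i := by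
  rintro ⟨h, hh, hJ⟩
  exact hv_step3 hψ hψ0 hfin (hv_step1 hψ hψ0 hfin h hh hJ)
end

section
/- Let f = (f₁,…,f_p) : U → ℂ^p be a holomorphic map on an open set U ⊆ ℂⁿ whose zero fiber X₀ = f⁻¹(0) is a geometric complete intersection of dimension n − p. Then f is an open map in a neighbourhood of X₀. -/
open Filter Topology

/-- The ring of germs at a point `a ∈ ℂⁿ` of holomorphic functions, realized as the
subring of germs at `a` of functions analytic at `a`. -/
noncomputable def AnalyticGermRingAt {n : ℕ} (a : Fin n → ℂ) : Subring (Filter.Germ (𝓝 a) ℂ) where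
  carrier := {g | ∃ f : (Fin n → ℂ) → ℂ, AnalyticAt ℂ f a ∧ g = (f : Filter.Germ (𝓝 a) ℂ)}
  one_mem' := ⟨fun _ => 1, analyticAt_const, rfl⟩
  zero_mem' := ⟨fun _ => 0, analyticAt_const, rfl⟩
  mul_mem' := by
    rintro x y ⟨f, hf, rfl⟩ ⟨g, hg, rfl⟩
    exact ⟨fun y => f y * g y, hf.mul hg, rfl⟩
  add_mem' := by
    rintro x y ⟨f, hf, rfl⟩ ⟨g, hg, rfl⟩
    exact ⟨fun y => f y + g y, hf.add hg, rfl⟩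
  neg_mem' := by
    rintro x ⟨f, hf, rfl⟩
    exact ⟨fun y => - f y, hf.neg, rfl⟩

/-- The germ at `a` of a function analytic at `a`, as an element of the germ ring. -/
noncomputable def analyticGermAt {n : ℕ} (a : Fin n → ℂ) (f : (Fin n → ℂ) → ℂ)
    (hf : AnalyticAt ℂ f a) : AnalyticGermRingAt a :=
  ⟨(f : Filter.Germ (𝓝 a) ℂ), f, hf, rfl⟩

namespace FMT

/-- Absolutely summable families of coefficients indexed by words in `n` letters. -/
noncomputable abbrev B (n : ℕ) := lp (fun _ : List (Fin n) => ℂ) 1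

noncomputable abbrev sg {n : ℕ} (s : List (Fin n)) : B n := lp.single 1 s (1 : ℂ)

lemma norm_sg {n : ℕ} (s : List (Fin n)) : ‖sg s‖ = 1 := by
  simp [sg, lp.norm_single]

lemma hasSum_norm {n : ℕ} (u : B n) : HasSum (fun s => ‖u s‖) ‖u‖ := by
  have := lp.hasSum_norm (p := 1) (by simp) u
  simpa using this

lemma hasSum_sg {n : ℕ} (u : B n) : HasSum (fun s => u s • sg s) u := by
  have := lp.hasSum_single (p := 1) (by simp) u
  convert this using 2 with s
  rw [← lp.single_smul]; simp

lemma ext_sg {n : ℕ} {X : Type*} [NormedAddCommGroup X] [NormedSpace ℂ X] {T S : B n →L[ℂ] X} (h : ∀ s, T (sg s) = S (sg s)) : T = S := by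
  ext u
  have h1 := (hasSum_sg u).mapL T
  have h2 := (hasSum_sg u).mapL S
  refine h1.unique ?_
  convert h2 using 2 with s
  simp [h]

lemma lift_summable {n : ℕ} {X : Type*} [NormedAddCommGroup X] [NormedSpace ℂ X] (x : List (Fin n) → X) (hx : ∀ s, ‖x s‖ ≤ 1) (u : B n) :
    Summable (fun s => ‖u s • x s‖) := by
  refine Summable.of_nonneg_of_le (fun _ => norm_nonneg _) (fun s => ?_) (hasSum_norm u).summable
  rw [norm_smul]
  exact mul_le_of_le_one_right (norm_nonneg _) (hx s)

section lift
variable {n : ℕ} {X : Type*} [NormedAddCommGroup X] [NormedSpace ℂ X] [CompleteSpace X]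

/-- The universal property of `ℓ¹`. -/
noncomputable def lift (x : List (Fin n) → X) (hx : ∀ s, ‖x s‖ ≤ 1) : B n →L[ℂ] X :=
  LinearMap.mkContinuous
    { toFun := fun u => ∑' s, u s • x s
      map_add' := fun u v => by
        rw [← ((lift_summable x hx u).of_norm).tsum_add ((lift_summable x hx v).of_norm)]
        congr 1; ext s; simp [add_smul]
      map_smul' := fun c u => by
        simp only [RingHom.id_apply]
        rw [← ((lift_summable x hx u).of_norm).tsum_const_smul]
        congr 1; ext s; simp [mul_smul] } 1 (fun u => by
    simp only [LinearMap.coe_mk, AddHom.coe_mk, one_mul]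
    refine (norm_tsum_le_tsum_norm (lift_summable x hx u)).trans ?_
    rw [← (hasSum_norm u).tsum_eq]
    refine (lift_summable x hx u).tsum_le_tsum (fun s => ?_) (hasSum_norm u).summable
    rw [norm_smul]
    exact mul_le_of_le_one_right (norm_nonneg _) (hx s))

lemma lift_apply (x : List (Fin n) → X) (hx : ∀ s, ‖x s‖ ≤ 1) (u : B n) :
    lift x hx u = ∑' s, u s • x s := rfl

lemma norm_lift_le (x : List (Fin n) → X) (hx : ∀ s, ‖x s‖ ≤ 1) : ‖lift x hx‖ ≤ 1 :=
  LinearMap.mkContinuous_norm_le _ zero_le_one _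

lemma lift_sg (x : List (Fin n) → X) (hx : ∀ s, ‖x s‖ ≤ 1) (s) : lift x hx (sg s) = x s := by
  rw [lift_apply, tsum_eq_single s]
  · simp [sg]
  · intro t ht
    simp [sg, lp.single_apply, ht]

end lift

/-- monomial attached to a word -/
def mon {n : ℕ} (y : Fin n → ℂ) (s : List (Fin n)) : ℂ := (s.map y).prod

lemma mon_append {n : ℕ} (y : Fin n → ℂ) (s t) : mon y (s ++ t) = mon y s * mon y t := by
  simp [mon]

lemma norm_mon_le {n : ℕ} (y : Fin n → ℂ) (hy : ‖y‖ ≤ 1) (s) : ‖mon y s‖ ≤ 1 := by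
  induction s with
  | nil => simp [mon]
  | cons i s ih =>
    have : mon y (i :: s) = y i * mon y s := by simp [mon]
    rw [this, norm_mul]
    exact mul_le_one₀ ((norm_le_pi_norm y i).trans hy) (norm_nonneg _) ih

lemma mon_smul {n : ℕ} (c : ℂ) (y : Fin n → ℂ) (s) : mon (c • y) s = c ^ s.length * mon y s := by
  induction s with
  | nil => simp [mon]
  | cons i s ih =>
    have h : ∀ y : Fin n → ℂ, mon y (i :: s) = y i * mon y s := fun y => by simp [mon]
    rw [h, h, ih]; simp [pow_succ]; ring

noncomputable def ev {n : ℕ} (y : Fin n → ℂ) (hy : ‖y‖ ≤ 1) : B n →L[ℂ] ℂ :=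
  lift (mon y) (norm_mon_le y hy)

/-- left shift -/
noncomputable def S {n : ℕ} (t : List (Fin n)) : B n →L[ℂ] B n :=
  lift (fun s => sg (t ++ s)) (fun _ => (norm_sg _).le)

/-- multiplication -/
noncomputable def M {n : ℕ} : B n →L[ℂ] B n →L[ℂ] B n :=
  lift (fun t => S t) (fun _ => norm_lift_le _ _)

/-- left division by a word -/
noncomputable def Q {n : ℕ} (t : List (Fin n)) : B n →L[ℂ] B n :=
  lift (fun s => if t <+: s then sg (s.drop t.length) else 0) (fun s => by
    split_ifs
    · exact (norm_sg _).le
    · simp)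

noncomputable def coef {n : ℕ} (t : List (Fin n)) : B n →L[ℂ] ℂ :=
  lift (fun s => if t = s then 1 else 0) (fun s => by split_ifs <;> simp)

lemma ev_sg {n : ℕ} (y : Fin n → ℂ) (hy) (s) : ev y hy (sg s) = mon y s := lift_sg _ _ _

lemma ev_S {n : ℕ} (y : Fin n → ℂ) (hy) (t) (u) : ev y hy (S t u) = mon y t * ev y hy u := by
  have : (ev y hy).comp (S t) = mon y t • ev y hy := by
    apply ext_sg; intro s
    simp only [ContinuousLinearMap.comp_apply, S, lift_sg, ev_sg, mon_append]
    simp [ev_sg]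
  exact congrArg (fun T => T u) this

lemma ev_M {n : ℕ} (y : Fin n → ℂ) (hy) (a u) :
    ev y hy (M a u) = ev y hy a * ev y hy u := by
  have : (ContinuousLinearMap.compL ℂ (B n) (B n) ℂ (ev y hy)).comp M =
      (ContinuousLinearMap.lsmul ℂ ℂ).flip (ev y hy) ∘L (ev y hy) := by
    apply ext_sg; intro s
    ext u
    have h : M (sg s) = S s := lift_sg _ _ _
    simp [h, ev_S, ev_sg]
  have := congrArg (fun T => T a u) this
  simpa using this

noncomputable def wordsLT (n N : ℕ) : Finset (List (Fin n)) := (List.finite_length_lt (Fin n) N).toFinset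
noncomputable def wordsEQ (n N : ℕ) : Finset (List (Fin n)) := (List.finite_length_eq (Fin n) N).toFinset

lemma mem_wordsLT {n N : ℕ} {s : List (Fin n)} : s ∈ wordsLT n N ↔ s.length < N := by simp [wordsLT]
lemma mem_wordsEQ {n N : ℕ} {s : List (Fin n)} : s ∈ wordsEQ n N ↔ s.length = N := by simp [wordsEQ]

lemma ev_decomp {n : ℕ} (N : ℕ) (y : Fin n → ℂ) (hy) (u : B n) :
    ev y hy u = ∑ s ∈ wordsLT n N, coef s u * mon y s +
      ∑ t ∈ wordsEQ n N, mon y t * ev y hy (Q t u) := by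
  have : ev y hy = ∑ s ∈ wordsLT n N, mon y s • coef s +
      ∑ t ∈ wordsEQ n N, mon y t • (ev y hy).comp (Q t) := by
    apply ext_sg; intro s
    simp only [_root_.add_apply, _root_.sum_apply,
      _root_.smul_apply, ContinuousLinearMap.comp_apply, ev_sg, coef, Q, lift_sg,
      smul_eq_mul, mul_ite, mul_one, mul_zero]
    by_cases hs : s.length < N
    · rw [Finset.sum_ite_eq_of_mem' _ _ _ (mem_wordsLT.2 hs), Finset.sum_eq_zero, add_zero]
      intro t ht
      rw [if_neg]; · simp
      intro h
      have := h.length_le; rw [mem_wordsEQ.1 ht] at this; omega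
    · rw [Finset.sum_ite_eq', if_neg (fun h => hs (mem_wordsLT.1 h)), zero_add, Finset.sum_eq_single (s.take N)]
      · rw [if_pos (List.take_prefix N s), ev_sg, ← mon_append]
        simp
        congr 1
        rw [min_eq_left (by omega)]; simp
      · intro t ht hne
        rw [if_neg]; · simp
        intro h
        apply hne
        rw [List.prefix_iff_eq_take.1 h, mem_wordsEQ.1 ht]
      · intro h; exact absurd (mem_wordsEQ.2 (by simp; omega)) h
  have := congrArg (fun T => T u) this
  simpa [mul_comm] using this

end FMT

namespace FMT

lemma ev_step {n : ℕ} (y : Fin n → ℂ) (hy) (u : B n) :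
    ev y hy u = coef [] u + ∑ i, y i * ev y hy (Q [i] u) := by
  have : ev y hy = coef [] + ∑ i, y i • (ev y hy).comp (Q [i]) := by
    apply ext_sg; intro s
    simp only [_root_.add_apply, _root_.sum_apply,
      _root_.smul_apply, ContinuousLinearMap.comp_apply, ev_sg, coef, Q, lift_sg,
      smul_eq_mul]
    cases s with
    | nil => simp [mon]
    | cons j s =>
      rw [Finset.sum_eq_single j]
      · simp [ev_sg, mon]
      · intro i _ hij
        simp [hij]
      · simp
  have := congrArg (fun T => T u) this
  simpa using this

noncomputable def evf {n : ℕ} (y : Fin n → ℂ) : B n →L[ℂ] ℂ :=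
  (coef []).comp (Ring.inverse (1 - ∑ i, y i • Q [i]))

/-- Resolvents of linear families of operators are analytic. -/
lemma resolvent_analyticAt {n k : ℕ} (G : Fin k → (B n →L[ℂ] B n)) :
    AnalyticAt ℂ (fun w : Fin k → ℂ => Ring.inverse (1 - ∑ l, w l • G l)) 0 := by
  have h1 : AnalyticAt ℂ (fun w : Fin k → ℂ => (1 : B n →L[ℂ] B n) - ∑ l, w l • G l) 0 := by
    have : ∀ l, AnalyticAt ℂ (fun w : Fin k → ℂ => w l) 0 := fun l =>
      (ContinuousLinearMap.proj (R := ℂ) (φ := fun _ : Fin k => ℂ) l).analyticAt 0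
    refine analyticAt_const.sub (Finset.analyticAt_fun_sum _ fun l _ => (this l).smul analyticAt_const)
  have h2 := analyticAt_inverse (𝕜 := ℂ) (1 : (B n →L[ℂ] B n)ˣ)
  refine AnalyticAt.fun_comp (f := fun w : Fin k → ℂ => (1 : B n →L[ℂ] B n) - ∑ l, w l • G l) ?_ h1
  simpa using h2

lemma resolvent_isUnit {n k : ℕ} (G : Fin k → (B n →L[ℂ] B n)) :
    ∀ᶠ w : Fin k → ℂ in 𝓝 0, IsUnit (1 - ∑ l, w l • G l) := by
  have h1 : Continuous (fun w : Fin k → ℂ => (1 : B n →L[ℂ] B n) - ∑ l, w l • G l) := by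
    fun_prop
  have : IsOpen {x : B n →L[ℂ] B n | IsUnit x} := Units.isOpen
  refine h1.continuousAt.eventually (this.mem_nhds ?_)
  simp

lemma evf_analyticAt {n : ℕ} : AnalyticAt ℂ (fun y : Fin n → ℂ => evf y) 0 := by
  have := resolvent_analyticAt (n := n) (fun i : Fin n => Q [i])
  exact ((ContinuousLinearMap.compL ℂ (B n) (B n) ℂ (coef [])).analyticAt _).fun_comp this

lemma inverse_apply {n : ℕ} {T : B n →L[ℂ] B n} (h : IsUnit T) (u : B n) :
    T (Ring.inverse T u) = u := by
  have := Ring.mul_inverse_cancel T h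
  exact congrArg (fun T => T u) this

lemma ev_eq_evf {n : ℕ} : ∀ᶠ y : Fin n → ℂ in 𝓝 0, ∃ hy : ‖y‖ ≤ 1, ∀ u, ev y hy u = evf y u := by
  have h1 : ∀ᶠ y : Fin n → ℂ in 𝓝 0, ‖y‖ ≤ 1 := by
    filter_upwards [Metric.ball_mem_nhds (0 : Fin n → ℂ) zero_lt_one] with y hy
    simpa using (mem_ball_zero_iff.1 hy).le
  filter_upwards [h1, resolvent_isUnit (n := n) (fun i : Fin n => Q [i])] with y hy hu
  refine ⟨hy, fun u => ?_⟩
  set T := (1 : B n →L[ℂ] B n) - ∑ l, y l • Q [l]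
  have h2 := ev_step y hy (Ring.inverse T u)
  have h3 := inverse_apply hu u
  have h4 : T (Ring.inverse T u) = Ring.inverse T u - ∑ l, y l • Q [l] (Ring.inverse T u) := by
    simp [T]
  have h5 : ev y hy u = ev y hy (Ring.inverse T u) - ∑ l, y l * ev y hy (Q [l] (Ring.inverse T u)) := by
    conv_lhs => rw [← h3, h4]
    simp
  rw [h5, h2]
  simp [evf, T]

lemma ev_eq_evf_at {n : ℕ} (a : Fin n → ℂ) (ρ : ℝ) : ∀ᶠ z in 𝓝 a,
    ∃ hy : ‖(ρ : ℂ)⁻¹ • (z - a)‖ ≤ 1, ∀ u : B n,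
      ev ((ρ : ℂ)⁻¹ • (z - a)) hy u = evf ((ρ : ℂ)⁻¹ • (z - a)) u := by
  have : Tendsto (fun z : Fin n → ℂ => (ρ : ℂ)⁻¹ • (z - a)) (𝓝 a) (𝓝 0) := by
    have h : ContinuousAt (fun z : Fin n → ℂ => (ρ : ℂ)⁻¹ • (z - a)) a := by fun_prop
    simpa [ContinuousAt] using h
  exact this.eventually (ev_eq_evf (n := n))

/-- Expansion of analytic germs in words. -/
lemma expansion {n : ℕ} (a : Fin n → ℂ) (h : (Fin n → ℂ) → ℂ) (hh : AnalyticAt ℂ h a) :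
    ∀ᶠ ρ : ℝ in 𝓝[>] 0, ∃ u : B n, ∀ᶠ z in 𝓝 a, h z = evf ((ρ : ℂ)⁻¹ • (z - a)) u := by
  obtain ⟨p, r, hp⟩ := hh
  obtain ⟨r', hr'0, hr'⟩ := ENNReal.lt_iff_exists_nnreal_btwn.1 hp.r_pos
  have hr'0' : 0 < r' := by exact_mod_cast hr'0
  obtain ⟨C, hC, hC'⟩ := p.norm_mul_pow_le_of_lt_radius (r := r') (hr'.trans_le hp.r_le)
  have hρ : ∀ᶠ ρ : ℝ in 𝓝[>] 0, 0 < ρ ∧ (n * ρ / r' : ℝ) < 1 := by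
    have : ContinuousAt (fun ρ : ℝ => (n * ρ / r' : ℝ)) 0 := by fun_prop
    have h2 := this.eventually (p := fun x => x < 1) (by simpa using eventually_lt_nhds (one_pos (α := ℝ)))
    filter_upwards [self_mem_nhdsWithin, nhdsWithin_le_nhds h2] with ρ h1 h2
    exact ⟨h1, h2⟩
  filter_upwards [hρ] with ρ ⟨hρ0, hρ1⟩
  let e : List (Fin n) → ℂ := fun s => p s.length (fun i => Pi.single (s.get i) 1)
  let d : List (Fin n) → ℂ := fun s => (ρ : ℂ) ^ s.length * e s
  have hebd : ∀ s, ‖e s‖ ≤ C / r' ^ s.length := by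
    intro s
    refine ((p s.length).le_opNorm _).trans ?_
    have : ∏ i, ‖(Pi.single (s.get i) 1 : Fin n → ℂ)‖ = 1 := by
      apply Finset.prod_eq_one; intro i _
      rw [Pi.norm_single]; simp
    rw [this, mul_one, le_div_iff₀ (by positivity)]
    exact hC' s.length
  have hdbd : ∀ s, ‖d s‖ ≤ C * (ρ / r') ^ s.length := by
    intro s
    simp only [d, norm_mul, norm_pow, Complex.norm_real, Real.norm_eq_abs, abs_of_pos hρ0]
    calc _ ≤ ρ ^ s.length * (C / r' ^ s.length) := by gcongr; exact hebd s
      _ = _ := by rw [div_pow]; ring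
  have key : Summable (fun x : Σ m : ℕ, (Fin m → Fin n) => C * ((ρ : ℝ) / r') ^ x.1) := by
    rw [summable_sigma_of_nonneg (fun x => by positivity)]
    refine ⟨fun m => (hasSum_fintype _).summable, ?_⟩
    simp only [tsum_fintype, Finset.sum_const, Finset.card_univ, Fintype.card_fun, Fintype.card_fin,
      nsmul_eq_mul]
    have : Summable (fun m : ℕ => C * (n * ρ / r' : ℝ) ^ m) :=
      (summable_geometric_of_lt_one (by positivity) hρ1).mul_left C
    refine this.congr fun m => ?_
    rw [mul_div_assoc, mul_pow]; push_cast; ring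
  let E : (Σ m : ℕ, (Fin m → Fin n)) ≃ List (Fin n) := List.equivSigmaTuple.symm
  have hE : ∀ x, E x = List.ofFn x.2 := fun x => rfl
  have hdS : Summable (fun s => ‖d s‖) := by
    rw [← E.summable_iff]
    refine Summable.of_nonneg_of_le (fun _ => norm_nonneg _) (fun x => ?_) key
    refine (hdbd _).trans ?_
    simp [hE]
  let u : B n := ⟨d, by
    apply memℓp_gen; simpa using hdS⟩
  refine ⟨u, ?_⟩
  have hev := ev_eq_evf_at a ρ
  have hρc : (ρ : ℂ) ≠ 0 := by exact_mod_cast hρ0.ne'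
  filter_upwards [hev, hp.eventually_hasSum_sub] with z ⟨hy, hz⟩ hs
  rw [← hz u]
  have h1 : ev ((ρ : ℂ)⁻¹ • (z - a)) hy u = ∑' s, e s * mon (z - a) s := by
    simp only [ev, lift_apply]
    congr 1; ext s
    rw [mon_smul]
    change d s • _ = _
    simp only [d, smul_eq_mul, inv_pow]
    field_simp
  have h2 : Summable (fun s => e s * mon (z - a) s) := by
    have := (lift_summable _ (norm_mon_le _ hy) u).of_norm
    refine this.congr fun s => ?_
    rw [mon_smul]
    change d s • _ = _
    simp only [d, smul_eq_mul, inv_pow]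
    field_simp
  rw [h1, ← E.tsum_eq]
  change _ = ∑' c, ((fun s => e s * mon (z - a) s) ∘ E) c
  rw [Summable.tsum_sigma' (fun m => (hasSum_fintype _).summable)
    ((E.summable_iff).2 h2), ← hs.tsum_eq]
  congr 1; ext m
  rw [tsum_fintype]
  have := (p m).toMultilinearMap.map_sum (g := fun (_ : Fin m) (j : Fin n) =>
    (Pi.single j ((z - a) j) : Fin n → ℂ))
  simp only [Finset.univ_sum_single] at this
  refine this.trans (Finset.sum_congr rfl fun s _ => ?_)
  have h3 : (fun i => (Pi.single (s i) ((z - a) (s i)) : Fin n → ℂ)) =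
    fun i => (z - a) (s i) • (Pi.single (s i) 1 : Fin n → ℂ) := by
    ext i : 1
    rw [← Pi.single_smul]; simp
  rw [h3, (p m).toMultilinearMap.map_smul_univ]
  have h4 : e (List.ofFn s) = p m (fun i => Pi.single (s i) 1) := by
    have : ∀ (l : ℕ) (hl : l = m) (t : Fin l → Fin n) (_ : ∀ i, t i = s (Fin.cast hl i)),
        p l (fun i => Pi.single (t i) 1) = p m (fun i => Pi.single (s i) 1) := by
      intro l hl t ht
      subst hl
      congr 1; ext i : 1; rw [ht]; rfl
    exact this _ (by simp) _ (by simp; intro i; rfl)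
  have h5 : mon (z - a) (List.ofFn s) = ∏ i, (z - a) (s i) := by
    simp only [mon, List.map_ofFn, List.prod_ofFn]; rfl
  change _ = e (List.ofFn s) * mon (z - a) (List.ofFn s)
  rw [h4, h5, smul_eq_mul, mul_comm]
  rfl

end FMT

namespace FMT

noncomputable abbrev O {n : ℕ} (a : Fin n → ℂ) := AnalyticGermRingAt a
noncomputable abbrev gm {n : ℕ} (a : Fin n → ℂ) (f : (Fin n → ℂ) → ℂ) (hf : AnalyticAt ℂ f a) : O a :=
  analyticGermAt a f hf

section
variable {n : ℕ} {a : Fin n → ℂ}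

lemma gm_eq_iff {f g : (Fin n → ℂ) → ℂ} {hf : AnalyticAt ℂ f a} {hg : AnalyticAt ℂ g a} :
    gm a f hf = gm a g hg ↔ f =ᶠ[𝓝 a] g := by
  rw [Subtype.ext_iff]
  exact Filter.Germ.coe_eq

lemma exists_gm (x : O a) : ∃ f, ∃ hf : AnalyticAt ℂ f a, x = gm a f hf := by
  obtain ⟨x, f, hf, rfl⟩ := x
  exact ⟨f, hf, rfl⟩

lemma gm_add {f g : (Fin n → ℂ) → ℂ} (hf : AnalyticAt ℂ f a) (hg : AnalyticAt ℂ g a) :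
    gm a f hf + gm a g hg = gm a (fun z => f z + g z) (hf.add hg) := rfl
lemma gm_mul {f g : (Fin n → ℂ) → ℂ} (hf : AnalyticAt ℂ f a) (hg : AnalyticAt ℂ g a) :
    gm a f hf * gm a g hg = gm a (fun z => f z * g z) (hf.mul hg) := rfl
lemma gm_sub {f g : (Fin n → ℂ) → ℂ} (hf : AnalyticAt ℂ f a) (hg : AnalyticAt ℂ g a) :
    gm a f hf - gm a g hg = gm a (fun z => f z - g z) (hf.sub hg) := rfl
lemma gm_zero : (0 : O a) = gm a (fun _ => 0) analyticAt_const := rfl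
lemma gm_one : (1 : O a) = gm a (fun _ => 1) analyticAt_const := rfl

lemma gm_sum {ι : Type*} (t : Finset ι) (f : ι → (Fin n → ℂ) → ℂ) (hf : ∀ i, AnalyticAt ℂ (f i) a) :
    ∑ i ∈ t, gm a (f i) (hf i) =
      gm a (fun z => ∑ i ∈ t, f i z) (Finset.analyticAt_fun_sum _ fun i _ => hf i) := by
  classical
  induction t using Finset.induction_on with
  | empty => simp [gm_zero]
  | insert i t hi ih => rw [Finset.sum_insert hi, ih, gm_add, gm_eq_iff]; simp [Finset.sum_insert hi]

lemma gm_pow {f : (Fin n → ℂ) → ℂ} (hf : AnalyticAt ℂ f a) (m : ℕ) :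
    gm a f hf ^ m = gm a (fun z => f z ^ m) (hf.pow m) := by
  induction m with
  | zero => simp [gm_one]
  | succ m ih => simp only [pow_succ]; rw [ih, gm_mul]

lemma gm_eq_zero_iff {f : (Fin n → ℂ) → ℂ} {hf : AnalyticAt ℂ f a} :
    gm a f hf = 0 ↔ ∀ᶠ z in 𝓝 a, f z = 0 := by
  rw [gm_zero, gm_eq_iff]; rfl

lemma coord_analytic (a : Fin n → ℂ) (i : Fin n) : AnalyticAt ℂ (fun z : Fin n → ℂ => z i - a i) a :=
  ((ContinuousLinearMap.proj (R := ℂ) (φ := fun _ : Fin n => ℂ) i).analyticAt a).sub analyticAt_const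

/-- coordinate germs -/
noncomputable def X (a : Fin n → ℂ) (i : Fin n) : O a := gm a (fun z => z i - a i) (coord_analytic a i)

lemma mon_analytic (a : Fin n → ℂ) (s : List (Fin n)) : AnalyticAt ℂ (fun z => mon (z - a) s) a := by
  induction s with
  | nil => simpa [mon] using analyticAt_const
  | cons i s ih =>
    have : (fun z => mon (z - a) (i :: s)) = fun z => (z i - a i) * mon (z - a) s := by
      ext z; simp [mon]
    rw [this]; exact (coord_analytic a i).mul ih

lemma prod_X (a : Fin n → ℂ) (s : List (Fin n)) :
    (s.map (X a)).prod = gm a (fun z => mon (z - a) s) (mon_analytic a s) := by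
  induction s with
  | nil => simp [mon, gm_one]
  | cons i s ih =>
    rw [List.map_cons, List.prod_cons, ih, X, gm_mul, gm_eq_iff]
    exact Eventually.of_forall fun z => by simp [mon]

lemma prod_X_mem (a : Fin n → ℂ) (s : List (Fin n)) :
    (s.map (X a)).prod ∈ (Ideal.span (Set.range (X a))) ^ s.length := by
  induction s with
  | nil => simp
  | cons i s ih =>
    rw [List.map_cons, List.prod_cons, List.length_cons, pow_succ']
    exact Ideal.mul_mem_mul (Ideal.subset_span ⟨i, rfl⟩) ih

end

/-- Pullback of germs. -/
noncomputable def pull {n k : ℕ} (a : Fin n → ℂ) (b : Fin k → ℂ) (φ : (Fin n → ℂ) → (Fin k → ℂ))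
    (hφ : AnalyticAt ℂ φ a) (hb : φ a = b) : O b →+* O a where
  toFun x := ⟨x.1.compTendsto φ (hb ▸ hφ.continuousAt), by
    obtain ⟨x, f, hf, rfl⟩ := x
    exact ⟨f ∘ φ, (hb ▸ hf : AnalyticAt ℂ f (φ a)).comp hφ, rfl⟩⟩
  map_one' := rfl
  map_zero' := rfl
  map_add' := by
    rintro ⟨x, f, hf, rfl⟩ ⟨y, g, hg, rfl⟩; rfl
  map_mul' := by
    rintro ⟨x, f, hf, rfl⟩ ⟨y, g, hg, rfl⟩; rfl

lemma pull_gm {n k : ℕ} (a : Fin n → ℂ) (b : Fin k → ℂ) (φ : (Fin n → ℂ) → (Fin k → ℂ))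
    (hφ : AnalyticAt ℂ φ a) (hb : φ a = b) (f) (hf : AnalyticAt ℂ f b) :
    pull a b φ hφ hb (gm b f hf) =
      gm a (fun z => f (φ z)) ((hb ▸ hf : AnalyticAt ℂ f (φ a)).comp hφ) := rfl

lemma analyticAt_family {n k : ℕ} {a : Fin n → ℂ} {g : Fin k → (Fin n → ℂ) → ℂ}
    (hg : ∀ l, AnalyticAt ℂ (g l) a) : AnalyticAt ℂ (fun z l => g l z) a :=
  analyticAt_pi_iff.2 hg

theorem finite_mapping {n p k N : ℕ} (a : Fin n → ℂ)
    (f : Fin p → (Fin n → ℂ) → ℂ) (hf : ∀ i, AnalyticAt ℂ (f i) a)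
    (g : Fin k → (Fin n → ℂ) → ℂ) (hg : ∀ i, AnalyticAt ℂ (g i) a) (hg0 : (fun l => g l a) = 0)
    (hN : Ideal.span (Set.range (X a)) ^ N ≤
      Ideal.span (Set.range fun i => gm a (f i) (hf i)) ⊔
      Ideal.span (Set.range fun i => gm a (g i) (hg i))) (h : O a) :
    ∃ c : List (Fin n) → O (0 : Fin k → ℂ),
      h - ∑ s ∈ wordsLT n N, pull a 0 (fun z l => g l z) (analyticAt_family hg) hg0 (c s) *
        (s.map (X a)).prod ∈ Ideal.span (Set.range fun i => gm a (f i) (hf i)) := by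
  have h1 : ∀ t : List (Fin n), ∃ (α : Fin p → (Fin n → ℂ) → ℂ) (β : Fin k → (Fin n → ℂ) → ℂ),
      (∀ i, AnalyticAt ℂ (α i) a) ∧ (∀ i, AnalyticAt ℂ (β i) a) ∧ (t.length = N →
        ∀ᶠ z in 𝓝 a, mon (z - a) t = ∑ i, α i z * f i z + ∑ l, β l z * g l z) := by
    intro t
    by_cases ht : t.length = N
    swap
    · exact ⟨fun _ _ => 0, fun _ _ => 0, fun _ => analyticAt_const, fun _ => analyticAt_const,
        fun h => absurd h ht⟩
    have h2 := hN (ht ▸ prod_X_mem a t)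
    obtain ⟨x, hx, y, hy, hxy⟩ := Submodule.mem_sup.1 h2
    obtain ⟨α, rfl⟩ := Ideal.mem_span_range_iff_exists_fun.1 hx
    obtain ⟨β, rfl⟩ := Ideal.mem_span_range_iff_exists_fun.1 hy
    choose α' hα hα' using fun i => exists_gm (α i)
    choose β' hβ hβ' using fun i => exists_gm (β i)
    refine ⟨α', β', hα, hβ, fun _ => ?_⟩
    simp only [hα', hβ', gm_mul] at hxy
    rw [prod_X, gm_sum _ (fun i z => α' i z * f i z) (fun i => (hα i).mul (hf i)),
      gm_sum _ (fun i z => β' i z * g i z) (fun i => (hβ i).mul (hg i)),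
      gm_add, gm_eq_iff] at hxy
    filter_upwards [hxy] with z hz
    exact hz.symm
  choose α β hα hβ hαβ using h1
  obtain ⟨H, hH, rfl⟩ := exists_gm h
  have e1 : ∀ᶠ ρ : ℝ in 𝓝[>] 0, ∀ t ∈ wordsEQ n N, ∀ i, ∃ u : B n,
      ∀ᶠ z in 𝓝 a, α t i z = evf ((ρ : ℂ)⁻¹ • (z - a)) u :=
    (Filter.eventually_all_finset _).2 fun t _ => eventually_all.2 fun i => expansion a _ (hα t i)
  have e2 : ∀ᶠ ρ : ℝ in 𝓝[>] 0, ∀ t ∈ wordsEQ n N, ∀ i, ∃ u : B n,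
      ∀ᶠ z in 𝓝 a, β t i z = evf ((ρ : ℂ)⁻¹ • (z - a)) u :=
    (Filter.eventually_all_finset _).2 fun t _ => eventually_all.2 fun i => expansion a _ (hβ t i)
  have e0 : ∀ᶠ ρ : ℝ in 𝓝[>] 0, 0 < ρ := self_mem_nhdsWithin
  obtain ⟨ρ, hρ0, h2, h3, uH, huH⟩ := (e0.and (e1.and (e2.and (expansion a H hH)))).exists
  have h2' : ∀ t, ∃ u : Fin p → B n, t ∈ wordsEQ n N → ∀ i, 
      ∀ᶠ z in 𝓝 a, α t i z = evf ((ρ : ℂ)⁻¹ • (z - a)) (u i) := fun t => by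
    by_cases ht : t ∈ wordsEQ n N
    · choose u hu using h2 t ht
      exact ⟨u, fun _ => hu⟩
    · exact ⟨0, fun h => absurd h ht⟩
  have h3' : ∀ t, ∃ u : Fin k → B n, t ∈ wordsEQ n N → ∀ i, 
      ∀ᶠ z in 𝓝 a, β t i z = evf ((ρ : ℂ)⁻¹ • (z - a)) (u i) := fun t => by
    by_cases ht : t ∈ wordsEQ n N
    · choose u hu using h3 t ht
      exact ⟨u, fun _ => hu⟩
    · exact ⟨0, fun h => absurd h ht⟩
  choose A hA using h2'
  choose Bb hB using h3'
  have hρc : (ρ : ℂ) ≠ 0 := by exact_mod_cast hρ0.ne'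
  let r : ℂ := (ρ : ℂ)⁻¹
  let Gf : Fin p → (B n →L[ℂ] B n) := fun i => ∑ t ∈ wordsEQ n N, r ^ N • (M (A t i)).comp (Q t)
  let Gg : Fin k → (B n →L[ℂ] B n) := fun i => ∑ t ∈ wordsEQ n N, r ^ N • (M (Bb t i)).comp (Q t)
  -- fundamental identity
  have key : ∀ᶠ z in 𝓝 a, ∀ u : B n, evf (r • (z - a)) u =
      ∑ s ∈ wordsLT n N, coef s u * (r ^ s.length * mon (z - a) s) +
      ∑ i, f i z * evf (r • (z - a)) (Gf i u) + ∑ l, g l z * evf (r • (z - a)) (Gg l u) := by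
    have k1 : ∀ᶠ z in 𝓝 a, ∀ t ∈ wordsEQ n N,
        mon (z - a) t = ∑ i, α t i z * f i z + ∑ l, β t l z * g l z :=
      (Filter.eventually_all_finset _).2 fun t ht => hαβ t (mem_wordsEQ.1 ht)
    have k2 : ∀ᶠ z in 𝓝 a, ∀ t ∈ wordsEQ n N, ∀ i, α t i z = evf (r • (z - a)) (A t i) :=
      (Filter.eventually_all_finset _).2 fun t ht => eventually_all.2 fun i => hA t ht i
    have k3 : ∀ᶠ z in 𝓝 a, ∀ t ∈ wordsEQ n N, ∀ i, β t i z = evf (r • (z - a)) (Bb t i) :=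
      (Filter.eventually_all_finset _).2 fun t ht => eventually_all.2 fun i => hB t ht i
    filter_upwards [ev_eq_evf_at a ρ, k1, k2, k3] with z ⟨hy, hz⟩ k1 k2 k3 u
    change ∀ u, ev (r • (z - a)) hy u = evf (r • (z - a)) u at hz
    have := ev_decomp N (r • (z - a)) hy u
    have hM : ∀ x y : B n, evf (r • (z - a)) (M x y) = evf (r • (z - a)) x * evf (r • (z - a)) y := by
      intro x y
      rw [← hz, ← hz, ← hz, ev_M]
    simp only [hz] at this
    rw [this]
    rw [add_assoc]
    congr 1
    · refine Finset.sum_congr rfl fun s _ => ?_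
      rw [mon_smul]
    · simp only [Gf, Gg, _root_.sum_apply, _root_.smul_apply, map_sum, map_smul,
        ContinuousLinearMap.comp_apply, hM, smul_eq_mul, Finset.mul_sum]
      rw [Finset.sum_comm, Finset.sum_comm (s := Finset.univ (α := Fin k)), ← Finset.sum_add_distrib]
      refine Finset.sum_congr rfl fun t ht => ?_
      rw [mon_smul, mem_wordsEQ.1 ht, k1 t ht, mul_add, add_mul, Finset.mul_sum, Finset.mul_sum,
        Finset.sum_mul, Finset.sum_mul]
      congr 1
      · refine Finset.sum_congr rfl fun i _ => ?_
        rw [k2 t ht]; ring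
      · refine Finset.sum_congr rfl fun i _ => ?_
        rw [k3 t ht]; ring
  let R : (Fin k → ℂ) → (B n →L[ℂ] B n) := fun w => Ring.inverse (1 - ∑ l, w l • Gg l)
  have hR : AnalyticAt ℂ R 0 := resolvent_analyticAt Gg
  have happ : ∀ (v : B n), AnalyticAt ℂ (fun w => R w v) 0 := fun v =>
    ((ContinuousLinearMap.apply ℂ (B n) v).analyticAt _).fun_comp hR
  have hc : ∀ s, AnalyticAt ℂ (fun w => coef s (R w uH) * r ^ s.length) 0 := fun s =>
    (((coef s).analyticAt _).fun_comp (happ uH)).mul analyticAt_const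
  refine ⟨fun s => gm 0 _ (hc s), ?_⟩
  have hG : AnalyticAt ℂ (fun z l => g l z) a := analyticAt_family hg
  have hRz : AnalyticAt ℂ (fun z => R (fun l => g l z) uH) a := by
    have : AnalyticAt ℂ (fun w => R w uH) ((fun z l => g l z) a) := by
      simp only [hg0]; exact happ uH
    exact this.fun_comp hG
  have hevz : AnalyticAt ℂ (fun z : Fin n → ℂ => evf (r • (z - a))) a := by
    have h4 : AnalyticAt ℂ (fun z : Fin n → ℂ => r • (z - a)) a :=
      by fun_prop
    have h5 : AnalyticAt ℂ (fun y : Fin n → ℂ => evf y) ((fun z : Fin n → ℂ => r • (z - a)) a) := by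
      simpa using evf_analyticAt
    exact AnalyticAt.fun_comp (f := fun z : Fin n → ℂ => r • (z - a)) h5 h4
  have hq : ∀ i, AnalyticAt ℂ (fun z => evf (r • (z - a)) (Gf i (R (fun l => g l z) uH))) a := by
    intro i
    have hb := ContinuousLinearMap.analyticAt_bilinear (ContinuousLinearMap.id ℂ (B n →L[ℂ] ℂ))
      ((fun z : Fin n → ℂ => ((evf (r • (z - a)) : B n →L[ℂ] ℂ), Gf i (R (fun l => g l z) uH))) a)
    exact hb.fun_comp (f := fun z : Fin n → ℂ => ((evf (r • (z - a)) : B n →L[ℂ] ℂ), Gf i (R (fun l => g l z) uH))) (AnalyticAt.prod hevz (((Gf i).analyticAt _).fun_comp hRz))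
  rw [Ideal.mem_span_range_iff_exists_fun]
  refine ⟨fun i => gm a _ (hq i), ?_⟩
  simp only [pull_gm, prod_X, gm_mul]
  rw [gm_sum _ (fun i z => evf (r • (z-a)) (Gf i (R (fun l => g l z) uH)) * f i z) (fun i => (hq i).mul (hf i)),
    gm_sum _ (fun s z => coef s (R (fun l => g l z) uH) * r^s.length * mon (z-a) s) (fun s => ((((coef s).analyticAt _).fun_comp hRz).mul analyticAt_const).mul (mon_analytic a s)), gm_sub, gm_eq_iff]
  have hU : ∀ᶠ z in 𝓝 a, IsUnit (1 - ∑ l, g l z • Gg l) := by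
    have : Tendsto (fun z l => g l z) (𝓝 a) (𝓝 (0 : Fin k → ℂ)) := by
      rw [← hg0]; exact hG.continuousAt
    exact this.eventually (resolvent_isUnit Gg)
  filter_upwards [key, huH, hU] with z hz hHz hUz
  have h6 := hz (R (fun l => g l z) uH)
  have h7 := inverse_apply hUz uH
  have h8 : R (fun l => g l z) uH - ∑ l, g l z • Gg l (R (fun l => g l z) uH) = uH := by
    refine Eq.trans ?_ h7
    simp [R, _root_.sum_apply]
  change H z = evf (r • (z - a)) uH at hHz
  have h9 := congrArg (evf (r • (z - a))) h8
  simp only [map_sub, map_sum, map_smul, smul_eq_mul] at h9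
  rw [hHz, ← h9, h6]
  simp only [mul_comm, mul_assoc, mul_left_comm]
  ring

end FMT

namespace FMT

lemma exists_ball_of_eventually {n : ℕ} {a : Fin n → ℂ} {P : (Fin n → ℂ) → Prop} (h : ∀ᶠ z in 𝓝 a, P z) :
    ∃ r > 0, ∀ z ∈ Metric.ball a r, P z := by
  obtain ⟨r, hr, h⟩ := Metric.eventually_nhds_iff_ball.1 h
  exact ⟨r, hr, h⟩

lemma eventually_zero_of_mul {n : ℕ} {a : Fin n → ℂ} {f g : (Fin n → ℂ) → ℂ} (hf : AnalyticAt ℂ f a)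
    (hg : AnalyticAt ℂ g a) (h : ∀ᶠ z in 𝓝 a, f z * g z = 0) (hf0 : ¬ ∀ᶠ z in 𝓝 a, f z = 0) :
    ∀ᶠ z in 𝓝 a, g z = 0 := by
  obtain ⟨r, hr, h1⟩ := exists_ball_of_eventually
    (hf.eventually_analyticAt.and (hg.eventually_analyticAt.and h))
  have h2 : ∃ᶠ z in 𝓝 a, ¬ f z = 0 := not_eventually.1 hf0
  obtain ⟨z, hz, hzr⟩ := (h2.and_eventually (Metric.ball_mem_nhds a hr)).exists
  have h3 : g =ᶠ[𝓝 z] 0 := by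
    filter_upwards [(h1 z hzr).1.continuousAt.eventually_ne hz, Metric.isOpen_ball.mem_nhds hzr] with w hw hwr
    exact (mul_eq_zero.1 (h1 w hwr).2.2).resolve_left hw
  have h4 : AnalyticOnNhd ℂ g (Metric.ball a r) := fun w hw => (h1 w hw).2.1
  have h5 := h4.eqOn_zero_of_preconnected_of_eventuallyEq_zero
    (convex_ball a r).isPreconnected hzr h3
  filter_upwards [Metric.ball_mem_nhds a hr] with w hw
  exact h5 hw

instance {n : ℕ} (a : Fin n → ℂ) : Nontrivial (O a) := ⟨0, 1, by
  intro h
  rw [gm_zero, gm_one, gm_eq_iff] at h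
  have := h.self_of_nhds
  simp at this⟩

instance {n : ℕ} (a : Fin n → ℂ) : IsDomain (O a) := by
  have : NoZeroDivisors (O a) := ⟨by
    intro x y hxy
    obtain ⟨f, hf, rfl⟩ := exists_gm x
    obtain ⟨g, hg, rfl⟩ := exists_gm y
    rw [gm_mul, gm_eq_zero_iff] at hxy
    by_cases h : ∀ᶠ z in 𝓝 a, f z = 0
    · left; rwa [gm_eq_zero_iff]
    · right; rw [gm_eq_zero_iff]; exact eventually_zero_of_mul hf hg hxy h⟩
  exact NoZeroDivisors.to_isDomain _

lemma krull_lift {R S : Type*} [CommRing R] [CommRing S] (φ : R →+* S) (hφ : φ.IsIntegral)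
    (hinj : Function.Injective φ) (p : ℕ → Ideal R) (hp : ∀ i, (p i).IsPrime) (k : ℕ)
    (hlt : ∀ i < k, p i < p (i + 1)) : (k : WithBot ℕ∞) ≤ ringKrullDim S := by
  let := φ.toAlgebra
  have : Algebra.IsIntegral R S := ⟨hφ⟩
  have key : ∀ m ≤ k, ∃ l : LTSeries (PrimeSpectrum S), l.length = m ∧
      l.last.asIdeal.comap (algebraMap R S) = p m := by
    intro m
    induction m with
    | zero =>
      intro _
      have := hp 0
      obtain ⟨Q, -, hQ, hQ'⟩ := Ideal.exists_ideal_over_prime_of_isIntegral (p 0) (⊥ : Ideal S) (by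
        intro x hx
        have : φ x = 0 := hx
        rw [(map_eq_zero_iff φ hinj).1 this]; exact zero_mem _)
      exact ⟨RelSeries.singleton _ ⟨Q, hQ⟩, rfl, hQ'⟩
    | succ m ih =>
      intro hm
      obtain ⟨l, hl, hl'⟩ := ih (by omega)
      have := hp (m + 1)
      have h1 := hlt m (by omega)
      obtain ⟨Q, hle, hQ, hQ'⟩ := Ideal.exists_ideal_over_prime_of_isIntegral (p (m + 1)) l.last.asIdeal
        (by rw [hl']; exact h1.le)
      have hlt' : l.last < (⟨Q, hQ⟩ : PrimeSpectrum S) := by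
        refine lt_of_le_of_ne hle ?_
        intro h
        have : l.last.asIdeal = Q := congrArg PrimeSpectrum.asIdeal h
        rw [this, hQ'] at hl'
        exact h1.ne hl'.symm
      refine ⟨l.snoc ⟨Q, hQ⟩ hlt', by simp [hl], ?_⟩
      rw [RelSeries.last_snoc]
      exact hQ'
  obtain ⟨l, hl, -⟩ := key k le_rfl
  rw [← hl]
  exact Order.LTSeries.length_le_krullDim l

/-- coordinate truncation -/
def trunc {k : ℕ} (j : ℕ) (w : Fin k → ℂ) : Fin k → ℂ := fun i => if (i : ℕ) < j then 0 else w i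

lemma trunc_analytic {k : ℕ} (j : ℕ) : AnalyticAt ℂ (trunc (k := k) j) 0 := by
  refine analyticAt_pi_iff.2 fun i => ?_
  by_cases h : (i : ℕ) < j
  · simpa [trunc, h] using analyticAt_const
  · simp only [trunc, h, if_false]
    exact (ContinuousLinearMap.proj (R := ℂ) (φ := fun _ : Fin k => ℂ) i).analyticAt 0

lemma trunc_zero {k : ℕ} (j : ℕ) : trunc (k := k) j 0 = 0 := by ext i; simp [trunc]

noncomputable def chain (k j : ℕ) : Ideal (O (0 : Fin k → ℂ)) :=
  RingHom.ker (pull 0 0 (trunc j) (trunc_analytic j) (trunc_zero j))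

lemma chain_prime (k j : ℕ) : (chain k j).IsPrime := RingHom.ker_isPrime _

lemma not_eventually_coord {k : ℕ} (i : Fin k) : ¬ ∀ᶠ z : Fin k → ℂ in 𝓝 0, z i = 0 := by
  intro h
  have hc : Tendsto (fun t : ℂ => Pi.single (M := fun _ : Fin k => ℂ) i t) (𝓝 0) (𝓝 0) := by
    have : Continuous (fun t : ℂ => Pi.single (M := fun _ : Fin k => ℂ) i t) := (ContinuousLinearMap.single ℂ (fun _ : Fin k => ℂ) i).continuous
    simpa using this.tendsto 0
  have h1 := hc.eventually h
  simp only [Pi.single_eq_same] at h1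
  have h2 : ({0} : Set ℂ) ∈ 𝓝 (0 : ℂ) := h1
  exact (not_isOpen_singleton (0 : ℂ)) (isOpen_singleton_iff_nhds_eq_pure _ |>.2 (le_antisymm (by
    rw [Filter.le_pure_iff]; exact h2) (pure_le_nhds _)))

lemma chain_lt (k j : ℕ) (hj : j < k) : chain k j < chain k (j + 1) := by
  refine lt_of_le_of_ne ?_ ?_
  · intro x hx
    obtain ⟨f, hf, rfl⟩ := exists_gm x
    rw [chain, RingHom.mem_ker, pull_gm, gm_eq_zero_iff] at hx ⊢
    have h1 : Tendsto (trunc (k := k) (j + 1)) (𝓝 0) (𝓝 0) := by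
      simpa [trunc_zero] using (trunc_analytic (k := k) (j + 1)).continuousAt.tendsto
    filter_upwards [h1.eventually hx] with z hz
    rw [← hz]
    congr 1
    ext i
    simp only [trunc]
    split_ifs <;> first | rfl | omega
  · intro h
    have h1 : X 0 ⟨j, hj⟩ ∈ chain k (j + 1) := by
      rw [chain, RingHom.mem_ker, X, pull_gm, gm_eq_zero_iff]
      exact Eventually.of_forall fun z => by simp [trunc]
    rw [← h, chain, RingHom.mem_ker, X, pull_gm, gm_eq_zero_iff] at h1
    simp only [trunc, lt_irrefl, if_false, Pi.zero_apply, sub_zero] at h1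
    exact not_eventually_coord _ h1

lemma le_dim_of_integral {k : ℕ} {S : Type*} [CommRing S] (φ : O (0 : Fin k → ℂ) →+* S)
    (hφ : φ.IsIntegral) (hinj : Function.Injective φ) : (k : WithBot ℕ∞) ≤ ringKrullDim S :=
  krull_lift φ hφ hinj (chain k) (chain_prime k) k (fun j hj => chain_lt k j hj)

end FMT

namespace FMT

lemma exists_direction {k : ℕ} (H : (Fin (k + 1) → ℂ) → ℂ) (hH : AnalyticAt ℂ H 0)
    (h0 : ¬ ∀ᶠ z in 𝓝 0, H z = 0) :
    ∃ v : Fin (k + 1) → ℂ, ∃ j, v j ≠ 0 ∧ ¬ ∀ᶠ t : ℂ in 𝓝 0, H (t • v) = 0 := by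
  by_cases hH0 : H 0 = 0
  swap
  · refine ⟨Pi.single 0 1, 0, by simp, fun h => hH0 ?_⟩
    simpa using h.self_of_nhds
  obtain ⟨r, hr, h1⟩ := exists_ball_of_eventually hH.eventually_analyticAt
  obtain ⟨v, hv, hvr⟩ := ((not_eventually.1 h0).and_eventually (Metric.ball_mem_nhds 0 hr)).exists
  have hv0 : v ≠ 0 := by rintro rfl; exact hv hH0
  obtain ⟨j, hj⟩ := Function.ne_iff.1 hv0
  refine ⟨v, j, hj, fun h => hv ?_⟩
  have hL : IsLinearMap ℝ (fun t : ℂ => t • v) :=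
    ⟨fun x y => add_smul _ _ _, fun c x => smul_assoc _ _ _⟩
  have hconv : Convex ℝ ((fun t : ℂ => t • v) ⁻¹' Metric.ball 0 r) :=
    (convex_ball 0 r).is_linear_preimage hL
  have han : AnalyticOnNhd ℂ (fun t : ℂ => H (t • v)) ((fun t : ℂ => t • v) ⁻¹' Metric.ball 0 r) := by
    intro t ht
    exact AnalyticAt.fun_comp (f := fun t : ℂ => t • v) (h1 _ ht) (by fun_prop)
  have := han.eqOn_zero_of_preconnected_of_eventuallyEq_zero hconv.isPreconnected
    (z₀ := 0) (by simpa using hr) h (x := 1) (by simpa using hvr)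
  simpa using this

lemma reduce {k : ℕ} (h : O (0 : Fin (k + 1) → ℂ)) (h0 : h ≠ 0) :
    ∃ (l : Fin k → (Fin (k + 1) → ℂ) → ℂ) (hl : ∀ i, AnalyticAt ℂ (l i) 0), (∀ i, l i 0 = 0) ∧
      ∀ i, X 0 i ∈ (Ideal.span {h} ⊔ Ideal.span (Set.range fun i => gm 0 (l i) (hl i))).radical := by
  obtain ⟨H, hH, rfl⟩ := exists_gm h
  rw [Ne, gm_eq_zero_iff] at h0
  obtain ⟨v, j, hvj, hv⟩ := exists_direction H hH h0
  let f : Fin k → (Fin (k + 1) → ℂ) → ℂ := fun i w =>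
    w (j.succAbove i) - (v (j.succAbove i) / v j) * w j
  have hproj : ∀ i : Fin (k + 1), AnalyticAt ℂ (fun w : Fin (k + 1) → ℂ => w i) 0 := fun i =>
    (ContinuousLinearMap.proj (R := ℂ) (φ := fun _ : Fin (k + 1) => ℂ) i).analyticAt 0
  have hf : ∀ i, AnalyticAt ℂ (f i) 0 := fun i => (hproj _).sub (analyticAt_const.mul (hproj _))
  let g : Fin 1 → (Fin (k + 1) → ℂ) → ℂ := fun _ w => w j
  have hg : ∀ i, AnalyticAt ℂ (g i) 0 := fun i => hproj j
  have hXj : X 0 j = gm 0 (g 0) (hg 0) := by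
    rw [X, gm_eq_iff]; exact Eventually.of_forall fun z => by simp [g]
  have hXi : ∀ i, X 0 (j.succAbove i) = gm 0 (f i) (hf i) +
      gm 0 (fun _ => v (j.succAbove i) / v j) analyticAt_const * X 0 j := by
    intro i
    rw [hXj, X, gm_mul, gm_add, gm_eq_iff]; exact Eventually.of_forall fun z => by simp [g, f]
  have hN : Ideal.span (Set.range (X (0 : Fin (k + 1) → ℂ))) ^ 1 ≤
      Ideal.span (Set.range fun i => gm 0 (f i) (hf i)) ⊔
      Ideal.span (Set.range fun i => gm 0 (g i) (hg i)) := by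
    rw [pow_one, Ideal.span_le]
    have hj' : X 0 j ∈ Ideal.span (Set.range fun i => gm 0 (f i) (hf i)) ⊔
      Ideal.span (Set.range fun i => gm 0 (g i) (hg i)) :=
      Ideal.mem_sup_right (Ideal.subset_span ⟨0, hXj.symm⟩)
    rintro _ ⟨i, rfl⟩
    rcases Fin.eq_self_or_eq_succAbove j i with rfl | ⟨i, rfl⟩
    · exact hj'
    · rw [hXi]
      exact add_mem (Ideal.mem_sup_left (Ideal.subset_span ⟨i, rfl⟩)) (Ideal.mul_mem_left _ _ hj')
  obtain ⟨c, hc⟩ := finite_mapping 0 f hf g hg rfl hN (gm 0 H hH)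
  have hw : wordsLT (k + 1) 1 = {[]} := by
    ext s; simp [mem_wordsLT]
  rw [hw, Finset.sum_singleton, List.map_nil, List.prod_nil, mul_one] at hc
  obtain ⟨C, hC, hcC⟩ := exists_gm (c [])
  rw [hcC, pull_gm] at hc
  have hC' : AnalyticAt ℂ (fun s : ℂ => C (fun _ => s)) 0 := 
    AnalyticAt.fun_comp (f := fun s : ℂ => fun _ : Fin 1 => s) (x := 0) hC
      (analyticAt_pi_iff.2 fun _ => analyticAt_id)
  have hCne : ¬ ∀ᶠ s : ℂ in 𝓝 0, C (fun _ => s) = 0 := by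
    intro hz
    apply hv
    obtain ⟨β, hβ⟩ := Ideal.mem_span_range_iff_exists_fun.1 hc
    choose β' hβ1 hβ2 using fun i => exists_gm (β i)
    simp only [hβ2, gm_mul] at hβ
    rw [gm_sum _ (fun i z => β' i z * f i z) (fun i => (hβ1 i).mul (hf i)), gm_sub, gm_eq_iff] at hβ
    have ht : Tendsto (fun t : ℂ => t • v) (𝓝 0) (𝓝 0) := by
      have : Continuous (fun t : ℂ => t • v) := by fun_prop
      simpa using this.tendsto 0
    have ht' : Tendsto (fun t : ℂ => t * v j) (𝓝 0) (𝓝 0) := by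
      have : Continuous (fun t : ℂ => t * v j) := by fun_prop
      simpa using this.tendsto 0
    filter_upwards [ht.eventually hβ, ht'.eventually hz] with t h1 h2
    have h3 : ∀ i, f i (t • v) = 0 := by
      intro i; simp only [f, Pi.smul_apply, smul_eq_mul]; field_simp; ring
    simp only [h3, mul_zero, Finset.sum_const_zero, g, Pi.smul_apply, smul_eq_mul, h2, sub_zero] at h1
    exact h1.symm
  obtain ⟨b, ψ, hψ, hψ0, hψe⟩ := hC'.exists_eventuallyEq_pow_smul_nonzero_iff.2 hCne
  have hXb : X 0 j ^ b ∈ Ideal.span {gm 0 H hH} ⊔ Ideal.span (Set.range fun i => gm 0 (f i) (hf i)) := by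
    have hpj : Tendsto (fun w : Fin (k + 1) → ℂ => w j) (𝓝 0) (𝓝 0) := by
      simpa using (continuous_apply j).tendsto (0 : Fin (k + 1) → ℂ)
    have hψ1 : AnalyticAt ℂ (fun w : Fin (k + 1) → ℂ => (ψ (w j))⁻¹) 0 :=
      (AnalyticAt.fun_comp (f := fun w : Fin (k + 1) → ℂ => w j) (x := 0) hψ (hproj j)).inv hψ0
    have hCg : AnalyticAt ℂ (fun z : Fin (k + 1) → ℂ => C (fun l => g l z)) 0 :=
      AnalyticAt.fun_comp (f := fun z l => g l z) (x := 0) hC (analyticAt_family hg)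
    have : X 0 j ^ b = gm 0 (fun w => (ψ (w j))⁻¹) hψ1 * gm 0 (fun z => C (fun l => g l z)) hCg := by
      rw [hXj, gm_pow, gm_mul, gm_eq_iff]
      filter_upwards [hpj.eventually hψe, hpj.eventually (hψ.continuousAt.eventually_ne hψ0)] with w h1 h2
      simp only [sub_zero, smul_eq_mul] at h1
      simp only [g, h1]
      field_simp
    rw [this]
    refine Ideal.mul_mem_left _ _ ?_
    have h5 : gm 0 H hH - (gm 0 H hH - gm 0 (fun z => C (fun l => g l z)) hCg) ∈
        Ideal.span {gm 0 H hH} ⊔ Ideal.span (Set.range fun i => gm 0 (f i) (hf i)) :=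
      sub_mem (Ideal.mem_sup_left (Ideal.subset_span rfl)) (Ideal.mem_sup_right hc)
    rwa [sub_sub_cancel] at h5
  refine ⟨f, hf, fun i => by simp [f], ?_⟩
  have hj' : X 0 j ∈ (Ideal.span {gm 0 H hH} ⊔ Ideal.span (Set.range fun i => gm 0 (f i) (hf i))).radical :=
    ⟨b, hXb⟩
  intro i
  rcases Fin.eq_self_or_eq_succAbove j i with rfl | ⟨i, rfl⟩
  · exact hj'
  · rw [hXi]
    exact add_mem (Ideal.le_radical (Ideal.mem_sup_right (Ideal.subset_span ⟨i, rfl⟩)))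
      (Ideal.mul_mem_left _ _ hj')

end FMT

namespace FMT

lemma isIntegral_of_span {R S ι : Type*} [CommRing R] [CommRing S] (φ : R →+* S) (T : Finset ι) (e : ι → S)
    (h : ∀ x, ∃ c : ι → R, x = ∑ s ∈ T, φ (c s) * e s) : φ.IsIntegral := by
  classical
  apply RingHom.Finite.to_isIntegral
  let _ := φ.toAlgebra
  refine ⟨⟨T.image e, ?_⟩⟩
  rw [eq_top_iff]
  rintro x -
  obtain ⟨c, rfl⟩ := h x
  refine Submodule.sum_mem _ fun s hs => ?_
  exact Submodule.smul_mem _ (c s) (Submodule.subset_span (by simpa using ⟨s, hs, rfl⟩))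

lemma gm_isUnit {n : ℕ} {a : Fin n → ℂ} {f : (Fin n → ℂ) → ℂ} (hf : AnalyticAt ℂ f a) (h : f a ≠ 0) :
    IsUnit (gm a f hf) := by
  refine IsUnit.of_mul_eq_one (gm a (fun z => (f z)⁻¹) (hf.inv h)) ?_
  rw [gm_mul, gm_one, gm_eq_iff]
  filter_upwards [hf.continuousAt.eventually_ne h] with z hz
  exact mul_inv_cancel₀ hz

lemma exists_N {n : ℕ} {a : Fin n → ℂ} (J : Ideal (O a)) (h : ∀ i, X a i ∈ J.radical) :
    ∃ N, Ideal.span (Set.range (X a)) ^ N ≤ J := by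
  refine Ideal.exists_pow_le_of_le_radical_of_fg (Ideal.span_le.2 ?_) ?_
  · rintro _ ⟨i, rfl⟩; exact h i
  · exact Submodule.fg_span (Set.finite_range _)

def Pk {n p : ℕ} (a : Fin n → ℂ) (f : Fin p → (Fin n → ℂ) → ℂ) (hf : ∀ i, AnalyticAt ℂ (f i) a) (k : ℕ) : Prop :=
  ∃ (g : Fin k → (Fin n → ℂ) → ℂ) (hg : ∀ i, AnalyticAt ℂ (g i) a), (∀ l, g l a = 0) ∧
    ∀ i, X a i ∈ (Ideal.span (Set.range fun i => gm a (f i) (hf i)) ⊔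
      Ideal.span (Set.range fun i => gm a (g i) (hg i))).radical

theorem exists_params {n p d : ℕ} (a : Fin n → ℂ)
    (f : Fin p → (Fin n → ℂ) → ℂ) (hf : ∀ i, AnalyticAt ℂ (f i) a)
    (hdim : ringKrullDim (O a ⧸ (Ideal.span (Set.range fun i => gm a (f i) (hf i))).radical) =
      (d : WithBot ℕ∞)) :
    ∃ k ≤ d, Pk a f hf k := by
  classical
  have hex : ∃ k, Pk a f hf k := by
    refine ⟨n, fun i z => z i - a i, coord_analytic a, fun l => sub_self _, fun i => ?_⟩
    exact Ideal.le_radical (Ideal.mem_sup_right (Ideal.subset_span ⟨i, rfl⟩))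
  obtain ⟨k, hk, hmin⟩ : ∃ k, Pk a f hf k ∧ ∀ m < k, ¬ Pk a f hf m :=
    ⟨Nat.find hex, Nat.find_spec hex, fun m hm => Nat.find_min hex hm⟩
  refine ⟨k, ?_, hk⟩
  obtain ⟨g, hg, hg0, hX⟩ := hk
  have hg0' : (fun l => g l a) = 0 := funext hg0
  obtain ⟨N, hN⟩ := exists_N _ hX
  set I := Ideal.span (Set.range fun i => gm a (f i) (hf i)) with hI
  let π := pull a 0 (fun z l => g l z) (analyticAt_family hg) hg0'
  let φ : O (0 : Fin k → ℂ) →+* O a ⧸ I.radical := (Ideal.Quotient.mk I.radical).comp π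
  have hIntg : φ.IsIntegral := by
    refine isIntegral_of_span φ (wordsLT n N) (fun s => Ideal.Quotient.mk I.radical (s.map (X a)).prod) ?_
    intro x
    obtain ⟨h, rfl⟩ := Ideal.Quotient.mk_surjective x
    obtain ⟨c, hc⟩ := finite_mapping a f hf g hg hg0' hN h
    refine ⟨c, ?_⟩
    have := Ideal.Quotient.eq.2 (Ideal.le_radical hc : _ ∈ I.radical)
    rw [this]
    simp [φ, π]
  have hne : (1 : O a) ∉ I.radical := by
    intro h1
    have : Subsingleton (O a ⧸ I.radical) :=
      Ideal.Quotient.subsingleton_iff.2 ((Ideal.eq_top_iff_one _).2 h1)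
    rw [ringKrullDim_eq_bot_of_subsingleton] at hdim
    exact absurd hdim (by simp)
  have hinj : Function.Injective φ := by
    rw [injective_iff_map_eq_zero]
    intro h hh
    by_contra h0
    have hh' : π h ∈ I.radical := Ideal.Quotient.eq_zero_iff_mem.1 hh
    cases k with
    | zero =>
      obtain ⟨H, hH, rfl⟩ := exists_gm h
      have : H 0 ≠ 0 := by
        intro h1
        apply h0
        rw [gm_eq_zero_iff]
        exact Eventually.of_forall fun z => by rw [Subsingleton.elim z 0, h1]
      have hu := (gm_isUnit hH this).map π
      exact hne ((Ideal.eq_top_iff_one _).1 (Ideal.eq_top_of_isUnit_mem _ hh' hu))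
    | succ k =>
      obtain ⟨l, hl, hl0, hlX⟩ := reduce h h0
      apply hmin k (Nat.lt_succ_self k)
      have hlg : ∀ i, AnalyticAt ℂ (fun z => l i (fun m => g m z)) a := fun i =>
        AnalyticAt.fun_comp (f := fun z m => g m z) (by rw [hg0']; exact hl i) (analyticAt_family hg)
      refine ⟨fun i z => l i (fun m => g m z), hlg, fun i => (congrArg (l i) hg0').trans (hl0 i), ?_⟩
      rw [← hI]
      set J' := I ⊔ Ideal.span (Set.range fun i => gm a (fun z => l i (fun m => g m z)) (hlg i)) with hJ'
      have h1 : Ideal.span {h} ⊔ Ideal.span (Set.range fun i => gm 0 (l i) (hl i)) ≤ J'.radical.comap π := by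
        refine sup_le (Ideal.span_le.2 ?_) (Ideal.span_le.2 ?_)
        · rintro _ rfl
          exact Ideal.radical_mono le_sup_left hh'
        · rintro _ ⟨i, rfl⟩
          exact Ideal.le_radical (Ideal.mem_sup_right (Ideal.subset_span ⟨i, rfl⟩))
      have h2 : ∀ i, gm a (g i) (hg i) ∈ J'.radical := by
        intro i
        obtain ⟨m, hm⟩ := hlX i
        have h3 : (π (X 0 i)) ^ m ∈ J'.radical := by
          rw [← map_pow]; exact h1 hm
        have h4 : π (X 0 i) = gm a (g i) (hg i) := by
          rw [X, pull_gm, gm_eq_iff]; exact Eventually.of_forall fun z => by simp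
        rw [h4] at h3
        exact Ideal.radical_isRadical J' ⟨m, h3⟩
      intro i
      have h5 : I ⊔ Ideal.span (Set.range fun i => gm a (g i) (hg i)) ≤ J'.radical :=
        sup_le (le_sup_left.trans Ideal.le_radical) (Ideal.span_le.2 (by rintro _ ⟨i, rfl⟩; exact h2 i))
      have h6 := Ideal.radical_mono h5 (hX i)
      rwa [Ideal.radical_idem] at h6
  have := le_dim_of_integral φ hIntg hinj
  rw [hdim] at this
  exact_mod_cast this

end FMT

namespace FMT

lemma avoid {L Z : Set ℂ} (hL : IsOpen L) (hseg : ∀ t ∈ Set.Icc (0 : ℝ) 1, (t : ℂ) ∈ L)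
    (hZ : Z.Countable) (h0 : (0 : ℂ) ∉ Z) (h1 : (1 : ℂ) ∉ Z) :
    ∃ s : ℝ, ∀ t ∈ Set.Icc (0 : ℝ) 1, ((t : ℂ) + Complex.I * (s * (t * (1 - t)) : ℝ)) ∈ L ∧
      ((t : ℂ) + Complex.I * (s * (t * (1 - t)) : ℝ)) ∉ Z := by
  have e1 : ∀ᶠ s : ℝ in 𝓝 0, ∀ t ∈ Set.Icc (0 : ℝ) 1,
      ((t : ℂ) + Complex.I * (s * (t * (1 - t)) : ℝ)) ∈ L := by
    refine isCompact_Icc.eventually_forall_of_forall_eventually fun t ht => ?_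
    have hc : Continuous (fun q : ℝ × ℝ => ((q.2 : ℂ) + Complex.I * (q.1 * (q.2 * (1 - q.2)) : ℝ))) := by
      fun_prop
    refine hc.continuousAt.eventually_mem (hL.mem_nhds ?_)
    simpa using hseg t ht
  have hd : Dense ((fun z : ℂ => z.im / (z.re * (1 - z.re))) '' Z)ᶜ :=
    (hZ.image _).dense_compl ℝ
  obtain ⟨s, hs1, hs2⟩ := ((hd 0 |> mem_closure_iff_frequently.1).and_eventually e1).exists
  refine ⟨s, fun t ht => ⟨hs2 t ht, fun hz => ?_⟩⟩
  rcases eq_or_ne t 0 with rfl | ht0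
  · simp at hz; exact h0 hz
  rcases eq_or_ne t 1 with rfl | ht1
  · simp at hz; exact h1 hz
  apply hs1
  refine ⟨_, hz, ?_⟩
  have : 1 - t ≠ 0 := sub_ne_zero.2 (Ne.symm ht1)
  have e2 : ((t : ℂ) + Complex.I * (s * (t * (1 - t)) : ℝ)).re = t := by
    simp [Complex.add_re, Complex.mul_re, -Complex.ofReal_mul]
  have e3 : ((t : ℂ) + Complex.I * (s * (t * (1 - t)) : ℝ)).im = s * (t * (1 - t)) := by
    simp [Complex.add_im, Complex.mul_im, -Complex.ofReal_mul]
  simp only [e2, e3]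
  field_simp

lemma countable_zeros {L : Set ℂ} (hL : Convex ℝ L) {f : ℂ → ℂ}
    (hf : AnalyticOnNhd ℂ f L) {p : ℂ} (hp : p ∈ L) (hfp : f p ≠ 0) : {t ∈ L | f t = 0}.Countable := by
  obtain ⟨t, ht, htc, hcov⟩ := TopologicalSpace.countable_cover_nhdsWithin
    (s := {t ∈ L | f t = 0}) (f := fun x => {x}) (by
    rintro x ⟨hx, hx0⟩
    rcases (hf x hx).eventually_eq_zero_or_eventually_ne_zero with h | h
    · exact absurd (hf.eqOn_zero_of_preconnected_of_eventuallyEq_zero hL.isPreconnected hx h hp) hfp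
    · rw [eventually_nhdsWithin_iff] at h
      rw [mem_nhdsWithin_iff_eventually]
      filter_upwards [h] with y hy hyZ
      by_contra hne
      exact hy hne hyZ.2)
  exact htc.mono (by simpa using hcov)

theorem open_top {n : ℕ} (F : (Fin n → ℂ) → (Fin n → ℂ)) (a : Fin n → ℂ) (hF : AnalyticAt ℂ F a)
    (α : (Fin n → ℂ) → ℂ) (hα : AnalyticAt ℂ α (F a)) (hα0 : ¬ ∀ᶠ z in 𝓝 a, α (F z) = 0)
    (hinj : ∀ᶠ z in 𝓝 a, α (F z) ≠ 0 → Function.Injective (fderiv ℂ F z))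
    (hfin : ∃ N ∈ 𝓝 a, ∀ w, {z ∈ N | F z = w}.Finite) :
    ∀ᶠ y in 𝓝 a, 𝓝 (F y) ≤ map F (𝓝 y) := by
  obtain ⟨N₀, hN₀, hfin⟩ := hfin
  obtain ⟨ε, hε, hV⟩ := exists_ball_of_eventually hα.eventually_analyticAt
  obtain ⟨r, hr, hN⟩ := exists_ball_of_eventually (hF.eventually_analyticAt.and
    ((hF.continuousAt.eventually_mem (Metric.ball_mem_nhds (F a) hε)).and (hinj.and hN₀)))
  have hαF : AnalyticOnNhd ℂ (fun z => α (F z)) (Metric.ball a r) := fun z hz =>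
    (hV _ (hN z hz).2.1).fun_comp (hN z hz).1
  have hαF0 : ∀ y ∈ Metric.ball a r, ¬ ∀ᶠ z in 𝓝 y, α (F z) = 0 := by
    intro y hy h
    apply hα0
    have := hαF.eqOn_zero_of_preconnected_of_eventuallyEq_zero (convex_ball a r).isPreconnected hy h
    filter_upwards [Metric.ball_mem_nhds a hr] with z hz using this hz
  have hαV : AnalyticOnNhd ℂ α (Metric.ball (F a) ε) := hV
  have hαV0 : ∀ q ∈ Metric.ball (F a) ε, ¬ ∀ᶠ w in 𝓝 q, α w = 0 := by
    intro q hq h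
    apply hα0
    have := hαV.eqOn_zero_of_preconnected_of_eventuallyEq_zero (convex_ball (F a) ε).isPreconnected hq h
    filter_upwards [Metric.ball_mem_nhds a hr] with z hz using this (hN z hz).2.1
  filter_upwards [Metric.ball_mem_nhds a hr] with y hy
  intro s hs
  rw [mem_map] at hs
  have e1 : ∀ᶠ z in 𝓝 y, z = y ∨ F z ≠ F y := by
    have h1 : ({z ∈ N₀ | F z = F y} \ {y})ᶜ ∈ 𝓝 y :=
      ((hfin (F y)).subset Set.sdiff_subset).isClosed.isOpen_compl.mem_nhds (by simp)
    filter_upwards [h1, Metric.isOpen_ball.mem_nhds hy] with z hz hzr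
    by_contra! hcon
    exact hz ⟨⟨(hN z hzr).2.2.2, hcon.2⟩, hcon.1⟩
  obtain ⟨ρ, hρ, hB⟩ := Metric.nhds_basis_closedBall.eventually_iff.1
    (e1.and ((Metric.isOpen_ball.eventually_mem hy).and hs))
  have hcB : ContinuousOn F (Metric.closedBall y ρ) := fun z hz =>
    (hN z (hB hz).2.1).1.continuousAt.continuousWithinAt
  have hAc : IsClosed (F '' Metric.closedBall y ρ) :=
    ((isCompact_closedBall y ρ).image_of_continuousOn hcB).isClosed
  have hSc : IsClosed (F '' Metric.sphere y ρ) :=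
    ((isCompact_sphere y ρ).image_of_continuousOn (hcB.mono Metric.sphere_subset_closedBall)).isClosed
  have hyS : F y ∉ F '' Metric.sphere y ρ := by
    rintro ⟨z, hz, hzy⟩
    rcases (hB (Metric.sphere_subset_closedBall hz)).1 with rfl | h
    · simp at hz; exact hρ.ne hz
    · exact h hzy
  obtain ⟨ε', hε', hV'⟩ := exists_ball_of_eventually
    ((hSc.isOpen_compl.eventually_mem hyS).and (Metric.isOpen_ball.eventually_mem (hN y hy).2.1))
  -- Claim 1
  have c1 : ∀ q ∈ Metric.ball (F y) ε', q ∈ F '' Metric.closedBall y ρ → α q ≠ 0 →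
      F '' Metric.closedBall y ρ ∈ 𝓝 q := by
    rintro q hq ⟨z, hz, rfl⟩ hαq
    have hzb : z ∈ Metric.ball y ρ := by
      rw [Metric.mem_ball]
      refine lt_of_le_of_ne hz fun h => ?_
      exact (hV' _ hq).1 ⟨z, h, rfl⟩
    have hzN := hN z (hB hz).2.1
    have hi := hzN.2.2.1 hαq
    have hsurj : Function.Surjective (fderiv ℂ F z) :=
      (LinearMap.injective_iff_surjective (f := (fderiv ℂ F z : (Fin n → ℂ) →ₗ[ℂ] (Fin n → ℂ)))).1 hi
    have hst : HasStrictFDerivAt F (fderiv ℂ F z) z := hzN.1.hasStrictFDerivAt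
    have := hst.map_nhds_eq_of_surj (LinearMap.range_eq_top.2 hsurj)
    rw [← this]
    exact image_mem_map (Metric.closedBall_mem_nhds_of_mem hzb)
  -- Claim 2
  obtain ⟨p, hpV, hpA, hp0⟩ : ∃ p ∈ Metric.ball (F y) ε', p ∈ F '' Metric.closedBall y ρ ∧ α p ≠ 0 := by
    obtain ⟨z, hz0, hzB, hzV⟩ := ((not_eventually.1 (hαF0 y hy)).and_eventually
      ((show ∀ᶠ z in 𝓝 y, z ∈ Metric.closedBall y ρ from Metric.closedBall_mem_nhds y hρ).and
      ((hN y hy).1.continuousAt.eventually_mem (Metric.ball_mem_nhds (F y) hε')))).exists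
    exact ⟨F z, hzV, ⟨z, hzB, rfl⟩, hz0⟩
  -- Claim 3
  have c3 : ∀ q ∈ Metric.ball (F y) ε', α q ≠ 0 → q ∈ F '' Metric.closedBall y ρ := by
    intro q hqV hq0
    let γ : ℂ → (Fin n → ℂ) := fun t => p + t • (q - p)
    have hγ : Continuous γ := by fun_prop
    let L := γ ⁻¹' Metric.ball (F y) ε'
    have hLo : IsOpen L := Metric.isOpen_ball.preimage hγ
    have hLc : Convex ℝ L := by
      have hlin : IsLinearMap ℝ (fun t : ℂ => t • (q - p)) :=
        ⟨fun x y => add_smul _ _ _, fun c x => smul_assoc _ _ _⟩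
      have := ((convex_ball (F y) ε').translate_preimage_right p).is_linear_preimage hlin
      exact this
    have h0L : (0 : ℂ) ∈ L := by simpa [L, γ] using hpV
    have h1L : (1 : ℂ) ∈ L := by simpa [L, γ] using hqV
    have hseg : ∀ t ∈ Set.Icc (0 : ℝ) 1, (t : ℂ) ∈ L := by
      intro t ht
      have := hLc h0L h1L (sub_nonneg.2 ht.2) ht.1 (by ring)
      simpa using this
    have hcnt : {t ∈ L | α (γ t) = 0}.Countable := by
      refine countable_zeros hLc (f := fun t => α (γ t)) (fun t ht => ?_) h0L (by simpa [γ] using hp0)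
      exact (hV _ (hV' _ ht).2).fun_comp (by fun_prop)
    obtain ⟨σ, hσ⟩ := avoid hLo hseg hcnt (by simp [γ, hp0]) (by simp [γ, hq0])
    let c : ℝ → (Fin n → ℂ) := fun t => γ ((t : ℂ) + Complex.I * (σ * (t * (1 - t)) : ℝ))
    have hc : Continuous c := hγ.comp (by fun_prop)
    have hcV : ∀ t ∈ Set.Icc (0 : ℝ) 1, c t ∈ Metric.ball (F y) ε' ∧ α (c t) ≠ 0 := fun t ht =>
      ⟨(hσ t ht).1, fun h => (hσ t ht).2 ⟨(hσ t ht).1, h⟩⟩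
    have hcl : IsClosed (c ⁻¹' (F '' Metric.closedBall y ρ)) := hAc.preimage hc
    have hnh : ∀ t ∈ Set.Icc (0 : ℝ) 1, t ∈ c ⁻¹' (F '' Metric.closedBall y ρ) →
        t ∈ interior (c ⁻¹' (F '' Metric.closedBall y ρ)) := fun t ht htA => by
      rw [mem_interior_iff_mem_nhds]
      exact hc.continuousAt.preimage_mem_nhds (c1 _ (hcV t ht).1 htA (hcV t ht).2)
    have hc0 : c 0 = p := by simp [c, γ]
    have hc1 : c 1 = q := by simp [c, γ]
    have h0I : (0 : ℝ) ∈ Set.Icc (0 : ℝ) 1 := by simp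
    have hsub := (isPreconnected_Icc (a := (0 : ℝ)) (b := 1)).subset_of_closure_inter_subset
      (u := interior (c ⁻¹' (F '' Metric.closedBall y ρ))) isOpen_interior
      ⟨0, h0I, hnh 0 h0I (by rw [Set.mem_preimage, hc0]; exact hpA)⟩ (by
        rintro t ⟨ht1, ht2⟩
        exact hnh t ht2 (closure_minimal interior_subset hcl ht1))
    have := interior_subset (hsub (show (1 : ℝ) ∈ Set.Icc (0 : ℝ) 1 by simp))
    rwa [Set.mem_preimage, hc1] at this
  -- Claim 4
  refine Filter.mem_of_superset (Metric.ball_mem_nhds (F y) hε') fun q hq => ?_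
  have hqA : q ∈ F '' Metric.closedBall y ρ := by
    rw [← hAc.closure_eq, mem_closure_iff_frequently]
    exact ((not_eventually.1 (hαV0 q (hV' q hq).2)).and_eventually
      (Metric.isOpen_ball.eventually_mem hq)).mono fun w hw => c3 w hw.2 hw.1
  obtain ⟨z, hz, rfl⟩ := hqA
  exact (hB hz).2.2

end FMT

namespace FMT
open Polynomial in
lemma exists_min_monic {R S : Type*} [CommRing R] [CommRing S] (π : R →+* S) (x : S) (hx : π.IsIntegralElem x) :
    ∃ P : R[X], P.Monic ∧ eval₂ π x P = 0 ∧
      ∀ Q : R[X], Q.Monic → eval₂ π x Q = 0 → P.natDegree ≤ Q.natDegree := by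
  classical
  have hex : ∃ d, ∃ P : R[X], P.Monic ∧ eval₂ π x P = 0 ∧ P.natDegree = d := by
    obtain ⟨P, h1, h2⟩ := hx
    exact ⟨_, P, h1, h2, rfl⟩
  obtain ⟨P, h1, h2, h3⟩ := Nat.find_spec hex
  refine ⟨P, h1, h2, fun Q hQ hQ' => ?_⟩
  rw [h3]
  exact Nat.find_min' hex ⟨Q, hQ, hQ', rfl⟩

open Polynomial in
lemma natDegree_pos_of_root {R S : Type*} [CommRing R] [CommRing S] [Nontrivial S] (π : R →+* S) (x : S)
    (P : R[X]) (hP : P.Monic) (h : eval₂ π x P = 0) : 0 < P.natDegree := by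
  rw [Nat.pos_iff_ne_zero]
  intro h0
  rw [hP.natDegree_eq_zero.1 h0] at h
  simp at h

open Polynomial in
lemma exists_separable {R S : Type*} [CommRing R] [CommRing S] [IsDomain S] (hR : ∀ d : ℕ, d ≠ 0 → IsUnit (d : R))
    (π : R →+* S) (x : S) (hx : π.IsIntegralElem x) :
    ∃ P : R[X], P.Monic ∧ eval₂ π x P = 0 ∧ eval₂ π x (derivative P) ≠ 0 := by
  obtain ⟨P, h1, h2, h3⟩ := exists_min_monic π x hx
  refine ⟨P, h1, h2, fun h => ?_⟩
  have hd := natDegree_pos_of_root π x P h1 h2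
  obtain ⟨u, hu⟩ := hR P.natDegree hd.ne'
  have hle : (C (↑u⁻¹ : R) * derivative P).natDegree ≤ P.natDegree - 1 :=
    (natDegree_C_mul_le _ _).trans (natDegree_derivative_le P)
  have hm : (C (↑u⁻¹ : R) * derivative P).Monic := by
    refine monic_of_natDegree_le_of_coeff_eq_one (P.natDegree - 1) hle ?_
    rw [coeff_C_mul, coeff_derivative]
    have e : P.natDegree - 1 + 1 = P.natDegree := by omega
    have e' : (((P.natDegree - 1 : ℕ) : R) + 1) = (P.natDegree : R) := by
      rw [← Nat.cast_add_one, e]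
    rw [e, e', h1.coeff_natDegree, one_mul, ← hu, Units.inv_mul]
  have := h3 _ hm (by rw [eval₂_mul, h, mul_zero])
  omega

open Polynomial in
lemma exists_norm {R S : Type*} [CommRing R] [CommRing S] [IsDomain S]
    (π : R →+* S) (x : S) (hx : π.IsIntegralElem x) (hx0 : x ≠ 0) :
    ∃ P : R[X], P.Monic ∧ eval₂ π x P = 0 ∧ π (P.coeff 0) ≠ 0 := by
  obtain ⟨P, h1, h2, h3⟩ := exists_min_monic π x hx
  refine ⟨P, h1, h2, fun h => ?_⟩
  have hd := natDegree_pos_of_root π x P h1 h2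
  have e := divX_mul_X_add P
  rw [← e, eval₂_add, eval₂_mul, eval₂_X, eval₂_C, h, add_zero] at h2
  have h4 := (mul_eq_zero.1 h2).resolve_right hx0
  have hn : P.divX.natDegree = P.natDegree - 1 := natDegree_divX_eq_natDegree_tsub_one
  have hm : P.divX.Monic := by
    refine monic_of_natDegree_le_of_coeff_eq_one (P.natDegree - 1) hn.le ?_
    rw [coeff_divX, Nat.sub_add_cancel hd, h1.coeff_natDegree]
  have := h3 _ hm h4
  omega

lemma natCast_gm {n : ℕ} (a : Fin n → ℂ) (d : ℕ) : (d : O a) = gm a (fun _ => (d : ℂ)) analyticAt_const := by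
  induction d with
  | zero => simp [gm_zero]
  | succ d ih => rw [Nat.cast_succ, ih, gm_one, gm_add, gm_eq_iff]; simp

lemma natCast_unit {n : ℕ} (a : Fin n → ℂ) (d : ℕ) (hd : d ≠ 0) : IsUnit (d : O a) := by
  rw [natCast_gm]; exact gm_isUnit _ (by exact_mod_cast hd)

lemma coefF_analytic {n k : ℕ} (a : Fin n → ℂ) (F : (Fin n → ℂ) → (Fin k → ℂ)) (hF : AnalyticAt ℂ F a)
    (hF0 : F a = 0) {c : (Fin k → ℂ) → ℂ} (hc : AnalyticAt ℂ c 0) : AnalyticAt ℂ (fun z => c (F z)) a :=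
  AnalyticAt.fun_comp (f := F) (by rw [hF0]; exact hc) hF

open Polynomial in
lemma poly_data {n k : ℕ} (a : Fin n → ℂ) (F : (Fin n → ℂ) → (Fin k → ℂ)) (hF : AnalyticAt ℂ F a) (hF0 : F a = 0)
    (P : (O (0 : Fin k → ℂ))[X]) (hP : P.Monic) (x : (Fin n → ℂ) → ℂ) (hx : AnalyticAt ℂ x a) :
    ∃ (d : ℕ) (c : ℕ → (Fin k → ℂ) → ℂ) (hc : ∀ m, AnalyticAt ℂ (c m) 0) (_ : c d = fun _ => 1),
      P.coeff 0 = gm 0 (c 0) (hc 0) ∧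
      (∃ h1, eval₂ (pull a 0 F hF hF0) (gm a x hx) P =
        gm a (fun z => ∑ m ∈ Finset.range (d + 1), c m (F z) * x z ^ m) h1) ∧
      (∃ h2, eval₂ (pull a 0 F hF hF0) (gm a x hx) (derivative P) =
        gm a (fun z => ∑ m ∈ Finset.range (d + 1), c m (F z) * (m * x z ^ (m - 1))) h2) := by
  have hch : ∀ m, ∃ (c : (Fin k → ℂ) → ℂ) (hc : AnalyticAt ℂ c 0), P.coeff m = gm 0 c hc ∧
      (m = P.natDegree → c = fun _ => 1) := by
    intro m
    by_cases hm : m = P.natDegree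
    · exact ⟨fun _ => 1, analyticAt_const, by rw [hm, hP.coeff_natDegree, gm_one], fun _ => rfl⟩
    · obtain ⟨c, hc, h⟩ := exists_gm (P.coeff m)
      exact ⟨c, hc, h, fun h => absurd h hm⟩
  choose c hc hcP hcd using hch
  have hcF : ∀ m, AnalyticAt ℂ (fun z => c m (F z)) a := fun m => coefF_analytic a F hF hF0 (hc m)
  refine ⟨P.natDegree, c, hc, hcd _ rfl, hcP 0, ⟨?_, ?_⟩, ⟨?_, ?_⟩⟩
  · exact Finset.analyticAt_fun_sum _ fun m _ => (hcF m).mul (hx.pow m)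
  · rw [eval₂_eq_sum_range]
    simp only [hcP, pull_gm, gm_pow, gm_mul]
    rw [gm_sum _ (fun m z => c m (F z) * x z ^ m) (fun m => (hcF m).mul (hx.pow m))]
  · exact Finset.analyticAt_fun_sum _ fun m _ => (hcF m).mul (analyticAt_const.mul (hx.pow (m - 1)))
  · rw [eval₂_eq_eval_map, ← derivative_map, derivative_eval,
      sum_over_range' _ (by simp) (P.natDegree + 1) (Nat.lt_succ_of_le natDegree_map_le)]
    simp only [coeff_map, hcP, pull_gm, natCast_gm, gm_pow, gm_mul]
    rw [gm_sum _ (fun m z => c m (F z) * m * x z ^ (m - 1))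
      (fun m => ((hcF m).mul analyticAt_const).mul (hx.pow (m - 1))), gm_eq_iff]
    exact Eventually.of_forall fun z => by simp only [mul_assoc]

end FMT

namespace FMT

lemma deriv_identity {n k : ℕ} (F : (Fin n → ℂ) → (Fin k → ℂ)) (z v : Fin n → ℂ) (hF : AnalyticAt ℂ F z)
    (d : ℕ) (c : ℕ → (Fin k → ℂ) → ℂ) (hc : ∀ m ∈ Finset.range (d + 1), AnalyticAt ℂ (c m) (F z)) (i : Fin n) (b : ℂ)
    (h0 : ∀ᶠ y in 𝓝 z, ∑ m ∈ Finset.range (d + 1), c m (F y) * (y i - b) ^ m = 0)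
    (hv : fderiv ℂ F z v = 0)
    (hD : ∑ m ∈ Finset.range (d + 1), c m (F z) * (m * (z i - b) ^ (m - 1)) ≠ 0) : v i = 0 := by
  let γ : ℂ → (Fin n → ℂ) := fun t => z + t • v
  have hγ0 : γ 0 = z := by simp [γ]
  have hγ : HasDerivAt γ v 0 := by
    have := ((hasDerivAt_id (0 : ℂ)).smul_const v).const_add z
    simpa [γ] using this
  have hFγ : HasDerivAt (fun t => F (γ t)) 0 0 := by
    have h1 : HasFDerivAt F (fderiv ℂ F z) (γ 0) := by
      rw [hγ0]; exact hF.differentiableAt.hasFDerivAt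
    have := h1.comp_hasDerivAt 0 hγ
    rwa [hv] at this
  have hcγ : ∀ m ∈ Finset.range (d + 1), HasDerivAt (fun t => c m (F (γ t))) 0 0 := by
    intro m hm
    have h1 : HasFDerivAt (c m) (fderiv ℂ (c m) (F z)) (F (γ 0)) := by
      rw [hγ0]; exact (hc m hm).differentiableAt.hasFDerivAt
    have := HasFDerivAt.comp_hasDerivAt (f := fun t => F (γ t)) 0 h1 hFγ
    rwa [map_zero] at this
  have hxγ : HasDerivAt (fun t => γ t i - b) (v i) 0 :=
    ((hasDerivAt_pi.1 hγ) i).sub_const b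
  have hsum : HasDerivAt (fun t => ∑ m ∈ Finset.range (d + 1), c m (F (γ t)) * (γ t i - b) ^ m)
      (∑ m ∈ Finset.range (d + 1), (0 * (γ 0 i - b) ^ m +
        c m (F (γ 0)) * (m * (γ 0 i - b) ^ (m - 1) * v i))) 0 :=
    HasDerivAt.fun_sum fun m hm => (hcγ m hm).mul (hxγ.pow m)
  have hzero : HasDerivAt (fun t => ∑ m ∈ Finset.range (d + 1), c m (F (γ t)) * (γ t i - b) ^ m) 0 0 := by
    refine (hasDerivAt_const (0 : ℂ) (0 : ℂ)).congr_of_eventuallyEq ?_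
    have ht : Tendsto γ (𝓝 0) (𝓝 z) := by
      have := hγ.continuousAt.tendsto; rwa [hγ0] at this
    exact ht.eventually h0
  have := hsum.unique hzero
  rw [hγ0] at this
  have h2 : (∑ m ∈ Finset.range (d + 1), c m (F z) * (m * (z i - b) ^ (m - 1))) * v i = 0 := by
    rw [← this, Finset.sum_mul]
    exact Finset.sum_congr rfl fun m _ => by ring
  exact (mul_eq_zero.1 h2).resolve_left hD

lemma finite_roots (d : ℕ) (c : ℕ → ℂ) (hcd : c d = 1) :
    {t : ℂ | ∑ m ∈ Finset.range (d + 1), c m * t ^ m = 0}.Finite := by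
  let P : Polynomial ℂ := ∑ m ∈ Finset.range (d + 1), Polynomial.C (c m) * Polynomial.X ^ m
  have hP : P ≠ 0 := by
    intro h
    have : P.coeff d = 1 := by simp [P, hcd]
    rw [h] at this; simp at this
  refine (P.roots.toFinset.finite_toSet).subset fun t ht => ?_
  simp only [Finset.mem_coe, Multiset.mem_toFinset, Polynomial.mem_roots hP, Polynomial.IsRoot.def]
  simpa [P, Polynomial.eval_finsetSum] using ht

theorem open_F {n : ℕ} (a : Fin n → ℂ) (F : Fin n → (Fin n → ℂ) → ℂ) (hF : ∀ i, AnalyticAt ℂ (F i) a)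
    (hF0 : ∀ i, F i a = 0)
    (hX : ∀ i, X a i ∈ (Ideal.span (Set.range fun i => gm a (F i) (hF i))).radical) :
    ∀ᶠ y in 𝓝 a, 𝓝 (fun i => F i y) ≤ map (fun z i => F i z) (𝓝 y) := by
  have hG : AnalyticAt ℂ (fun z i => F i z) a := analyticAt_family hF
  have hG0 : (fun z i => F i z) a = 0 := funext hF0
  set G : (Fin n → ℂ) → (Fin n → ℂ) := fun z i => F i z with hGdef
  let π := pull a 0 G hG hG0
  have hIntg : π.IsIntegral := by
    obtain ⟨N, hN⟩ := exists_N _ hX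
    refine isIntegral_of_span π (wordsLT n N) (fun s => (s.map (X a)).prod) fun x => ?_
    obtain ⟨c, hc⟩ := finite_mapping a (p := 0) (fun i => i.elim0) (fun i => i.elim0) F hF hG0
      (hN.trans le_sup_right) x
    refine ⟨c, ?_⟩
    have he : (Set.range fun i : Fin 0 => gm a (i.elim0) (i.elim0)) = ∅ := Set.range_eq_empty _
    rw [he, Ideal.span_empty, Ideal.mem_bot] at hc
    exact sub_eq_zero.1 hc
  choose P hPm hPr hPs using fun i => exists_separable (natCast_unit (0 : Fin n → ℂ)) π (X a i) (hIntg _)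
  choose d c hc hcd hc0 hcr hcs using fun i => poly_data a G hG hG0 (P i) (hPm i) _ (coord_analytic a i)
  choose hr hr' using hcr
  choose hs hs' using hcs
  have e1 : ∀ i, ∀ᶠ z in 𝓝 a, ∑ m ∈ Finset.range (d i + 1), c i m (G z) * (z i - a i) ^ m = 0 := fun i =>
    gm_eq_zero_iff.1 ((hr' i).symm.trans (hPr i))
  let D : Fin n → (Fin n → ℂ) → ℂ := fun i z =>
    ∑ m ∈ Finset.range (d i + 1), c i m (G z) * (m * (z i - a i) ^ (m - 1))
  have hD0 : ∀ i, gm a (D i) (hs i) ≠ 0 := fun i => by rw [← hs' i]; exact hPs i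
  obtain ⟨δ, hδ, hδe⟩ := exists_gm (∏ i, gm a (D i) (hs i))
  have hδ0 : gm a δ hδ ≠ 0 := by rw [← hδe]; exact Finset.prod_ne_zero_iff.2 fun i _ => hD0 i
  have hδD : ∀ᶠ z in 𝓝 a, ∏ i, D i z = δ z := by
    have : ∀ t : Finset (Fin n), ∃ h, ∏ i ∈ t, gm a (D i) (hs i) = gm a (fun z => ∏ i ∈ t, D i z) h := by
      classical
      intro t
      induction t using Finset.induction_on with
      | empty => exact ⟨by simpa using analyticAt_const, by simp [gm_one]⟩
      | insert i t hi ih =>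
        obtain ⟨h, ih⟩ := ih
        simp only [Finset.prod_insert hi]
        exact ⟨(hs i).mul h, by rw [ih, gm_mul]⟩
    obtain ⟨h, h'⟩ := this Finset.univ
    exact gm_eq_iff.1 (h'.symm.trans hδe)
  obtain ⟨Q, hQm, hQr, hQ0⟩ := exists_norm π _ (hIntg (gm a δ hδ)) hδ0
  obtain ⟨dq, q, hq, hqd, hq0, ⟨hqr, hqr'⟩, -⟩ := poly_data a G hG hG0 Q hQm δ hδ
  have e2 : ∀ᶠ z in 𝓝 a, ∑ m ∈ Finset.range (dq + 1), q m (G z) * δ z ^ m = 0 :=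
    gm_eq_zero_iff.1 (hqr'.symm.trans hQr)
  have hcA : ∀ᶠ z in 𝓝 a, ∀ i, ∀ m ∈ Finset.range (d i + 1), AnalyticAt ℂ (c i m) (G z) := by
    have ht : Tendsto G (𝓝 a) (𝓝 0) := by have := hG.continuousAt.tendsto; rwa [hG0] at this
    exact eventually_all.2 fun i => (Filter.eventually_all_finset _).2 fun m _ =>
      ht.eventually (hc i m).eventually_analyticAt
  refine open_top G a hG (q 0) (by rw [hG0]; exact hq 0) ?_ ?_ ?_
  · intro h
    apply hQ0
    rw [hq0, pull_gm, gm_eq_zero_iff]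
    exact h
  · filter_upwards [e2, hδD, hcA, hG.eventually_analyticAt,
      eventually_all.2 fun i => (e1 i).eventually_nhds] with z h2 hδz hcz hGz h1 hα
    have hδne : δ z ≠ 0 := by
      intro h
      apply hα
      rw [Finset.sum_eq_single 0] at h2
      · simpa using h2
      · intro m _ hm; rw [h, zero_pow hm, mul_zero]
      · simp
    have hDne : ∀ i, D i z ≠ 0 := fun i => by
      rw [← hδz] at hδne
      exact Finset.prod_ne_zero_iff.1 hδne i (Finset.mem_univ i)
    rw [injective_iff_map_eq_zero]
    intro v hv
    ext i
    exact deriv_identity G z v hGz (d i) (c i) (hcz i) i (a i) (h1 i) hv (hDne i)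
  · have e1' : ∀ᶠ z in 𝓝 a, ∀ i, ∑ m ∈ Finset.range (d i + 1), c i m (G z) * (z i - a i) ^ m = 0 :=
      eventually_all.2 e1
    refine ⟨_, e1', fun w => ?_⟩
    have hfi : (Set.pi Set.univ fun i => (fun t : ℂ => t - a i) ⁻¹'
        {t : ℂ | ∑ m ∈ Finset.range (d i + 1), c i m w * t ^ m = 0}).Finite := by
      refine Set.Finite.pi fun i => ?_
      refine (finite_roots (d i) (fun m => c i m w) (by simp [hcd])).preimage ?_
      exact (sub_left_injective).injOn
    refine hfi.subset ?_
    rintro z ⟨hz, rfl⟩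
    exact fun i _ => hz i

end FMT

namespace FMT

theorem open_near {n p : ℕ} (hpn : p ≤ n) (a : Fin n → ℂ)
    (f : Fin p → (Fin n → ℂ) → ℂ) (hf : ∀ i, AnalyticAt ℂ (f i) a) (hf0 : ∀ i, f i a = 0)
    (hdim : ringKrullDim (O a ⧸ (Ideal.span (Set.range fun i => gm a (f i) (hf i))).radical) =
      ((n - p : ℕ) : WithBot ℕ∞)) :
    ∀ᶠ y in 𝓝 a, 𝓝 (fun i => f i y) ≤ map (fun z i => f i z) (𝓝 y) := by
  obtain ⟨k, hk, g, hg, hg0, hX⟩ := exists_params a f hf hdim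
  let F : Fin n → (Fin n → ℂ) → ℂ := fun i =>
    if h : (i : ℕ) < p then f ⟨i, h⟩ else if h' : (i : ℕ) - p < k then g ⟨i - p, h'⟩ else fun _ => 0
  have hF : ∀ i, AnalyticAt ℂ (F i) a := by
    intro i
    simp only [F]
    split_ifs
    · exact hf _
    · exact hg _
    · exact analyticAt_const
  have hF0 : ∀ i, F i a = 0 := by
    intro i
    simp only [F]
    split_ifs
    · exact hf0 _
    · exact hg0 _
    · rfl
  have hle : Ideal.span (Set.range fun i => gm a (f i) (hf i)) ⊔
      Ideal.span (Set.range fun i => gm a (g i) (hg i)) ≤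
      Ideal.span (Set.range fun i => gm a (F i) (hF i)) := by
    refine sup_le (Ideal.span_le.2 ?_) (Ideal.span_le.2 ?_)
    · rintro _ ⟨i, rfl⟩
      refine Ideal.subset_span ⟨⟨i, by omega⟩, ?_⟩
      simp only [gm_eq_iff]
      simp [F]
    · rintro _ ⟨i, rfl⟩
      refine Ideal.subset_span ⟨⟨p + i, by omega⟩, ?_⟩
      simp only [gm_eq_iff]
      simp [F]
  have hopen := open_F a F hF hF0 fun i => Ideal.radical_mono hle (hX i)
  let pr : (Fin n → ℂ) →L[ℂ] (Fin p → ℂ) :=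
    ContinuousLinearMap.pi fun i => ContinuousLinearMap.proj (Fin.castLE hpn i)
  have hpr : IsOpenMap pr := by
    refine pr.isOpenMap fun u => ?_
    refine ⟨fun i => if h : (i : ℕ) < p then u ⟨i, h⟩ else 0, ?_⟩
    ext i
    simp [pr]
  have hfF : ∀ z, (fun i => f i z) = pr (fun i => F i z) := by
    intro z
    ext i
    simp [pr, F]
  filter_upwards [hopen] with y hy
  have h1 : (fun z i => f i z) = pr ∘ (fun z i => F i z) := funext hfF
  rw [hfF y, h1, ← Filter.map_map]
  exact (hpr.nhds_le _).trans (Filter.map_mono hy)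

end FMT

/-- Remmert-type openness: if `f = (f₁,…,f_p) : U → ℂᵖ` is holomorphic on an open set
`U ⊆ ℂⁿ` and the zero fiber `X₀ = f⁻¹(0)` is a geometric complete intersection of
dimension `n - p` (each of its germs has local dimension `n - p`, measured by the Krull
dimension of the reduced local ring of the germ), then `f` is an open map in a
neighbourhood of `X₀`. -/
theorem open_near_complete_intersection_fiber {n p : ℕ} (hpn : p ≤ n)
    (U : Set (Fin n → ℂ)) (hU : IsOpen U)
    (f : Fin p → (Fin n → ℂ) → ℂ) (hf : ∀ i, AnalyticOnNhd ℂ (f i) U)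
    (hdim : ∀ x, ∀ hx : x ∈ U, (∀ i, f i x = 0) →
      ringKrullDim (AnalyticGermRingAt x ⧸
        (Ideal.span (Set.range fun i => analyticGermAt x (f i) (hf i x hx))).radical) =
        ((n - p : ℕ) : WithBot (WithTop ℕ))) :
    ∃ W : Set (Fin n → ℂ), IsOpen W ∧ {x ∈ U | ∀ i, f i x = 0} ⊆ W ∧ W ⊆ U ∧
      ∀ O : Set (Fin n → ℂ), IsOpen O → O ⊆ W → IsOpen ((fun x (i : Fin p) => f i x) '' O) := by
  refine ⟨{y | y ∈ U ∧ ∀ᶠ y' in 𝓝 y, 𝓝 (fun i => f i y') ≤ map (fun z i => f i z) (𝓝 y')},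
    hU.inter isOpen_setOfPred_eventually_nhds, ?_, fun y hy => hy.1, ?_⟩
  · rintro x ⟨hx, hx0⟩
    exact ⟨hx, FMT.open_near hpn x f (fun i => hf i x hx) hx0 (hdim x hx hx0)⟩
  · intro O hO hOW
    rw [isOpen_iff_mem_nhds]
    rintro _ ⟨y, hy, rfl⟩
    exact (hOW hy).2.self_of_nhds (image_mem_map (hO.mem_nhds hy))
end
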